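/- arXiv:2104.03359 — 3 statements merged into one kernel-verified Lean document; each statement's English description precedes it below -/
import Mathlib

section
/- Let G be a polysurface group of length n with filtration 1 = G₀ ≤ G₁ ≤ ⋯ ≤ G_n = G, and let D be a subgroup of G of finite index d. Set D_i := D ∩ G_i. Then D is a polysurface group of length n with filtration 1 = D₀ ≤ D₁ ≤ ⋯ ≤ D_n = D: each D_i is normal in D, each quotient D_i/D_{i−1} is a surface group, and moreover the genus of D_i/D_{i−1} is at most d·(g(G_i/G_{i−1}) − 1) + 1, where g(G_i/G_{i−1}) denotes the genus of the surface group G_i/G_{i−1}. -/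
open scoped commutatorElement

/-- The single relator `[a₁,b₁]⋯[a_g,b_g]` of a genus-`g` surface group, in the free
group on generators `(i, true) = aᵢ` and `(i, false) = bᵢ`. -/
def surfaceRelator (g : ℕ) : FreeGroup (Fin g × Bool) :=
  (List.ofFn fun i : Fin g =>
    ⁅FreeGroup.of (i, true), FreeGroup.of (i, false)⁆).prod

/-- The surface group of genus `g`, presented as
`⟨a₁,b₁,…,a_g,b_g ∣ [a₁,b₁]⋯[a_g,b_g]⟩`. -/
abbrev SurfaceGroup (g : ℕ) :=
  PresentedGroup ({surfaceRelator g} : Set (FreeGroup (Fin g × Bool)))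

/-- A group is a surface group of genus `g` if it is isomorphic to `SurfaceGroup g`. -/
def IsSurfaceGroup (G : Type*) [Group G] (g : ℕ) : Prop :=
  Nonempty (G ≃* SurfaceGroup g)

/-- A group `G` is a polysurface group of length `n`: there is a filtration
`⊥ = G₀ ≤ G₁ ≤ ⋯ ≤ G_n = G` by normal subgroups of `G` whose successive quotients
are surface groups of genus at least 2 (the quotient `G_{i+1}/G_i` is expressed by a
surjection `G_{i+1} →* SurfaceGroup g` with kernel `G_i`). -/
def IsPolysurface (G : Type*) [Group G] (n : ℕ) : Prop :=
  ∃ Gs : Fin (n + 1) → Subgroup G,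
    Gs 0 = ⊥ ∧ Gs (Fin.last n) = ⊤ ∧ Monotone Gs ∧
    (∀ i, (Gs i).Normal) ∧
    ∀ i : Fin n, ∃ g : ℕ, 2 ≤ g ∧
      ∃ f : (Gs i.succ) →* SurfaceGroup g,
        Function.Surjective f ∧ f.ker = (Gs i.castSucc).subgroupOf (Gs i.succ)


namespace PS

/-- The opposite letter. -/
def inv {α : Type} (d : α × Bool) : α × Bool := (d.1, !d.2)

/-- `Path p e s w t`: reading `w` leads from colour `s` to colour `t`. -/
def Path {α K : Type} (p e : α × Bool → K) : K → List (α × Bool) → K → Prop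
  | s, [], t => s = t
  | s, d :: w, t => p d = s ∧ Path p e (e d) w t

@[simp] theorem inv_inv {α : Type} (d : α × Bool) : inv (inv d) = d := by
  simp [inv]

@[simp] theorem inv_fst {α : Type} (d : α × Bool) : (inv d).1 = d.1 := rfl

theorem inv_ne {α : Type} (d : α × Bool) : inv d ≠ d := by
  rcases d with ⟨x, b⟩
  cases b <;> simp [inv]

theorem inv_inj {α : Type} {d e : α × Bool} (h : inv d = inv e) : d = e := by
  rw [← inv_inv d, h, inv_inv]

theorem fst_eq {α : Type} {d e : α × Bool} (h : d.1 = e.1) : d = e ∨ d = inv e := by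
  rcases d with ⟨x, b⟩
  rcases e with ⟨y, c⟩
  simp only at h
  subst h
  cases b <;> cases c <;> simp [inv]

theorem path_append {α K : Type} (p e : α × Bool → K) (u v : List (α × Bool)) (s t : K) :
    Path p e s (u ++ v) t ↔ ∃ m, Path p e s u m ∧ Path p e m v t := by
  induction u generalizing s with
  | nil => simp [Path]
  | cons d u ih =>
    simp only [List.cons_append, Path, ih]
    constructor
    · rintro ⟨h, m, h1, h2⟩; exact ⟨m, ⟨h, h1⟩, h2⟩
    · rintro ⟨m, ⟨h, h1⟩, h2⟩; exact ⟨h, m, h1, h2⟩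

theorem path_congr {α K : Type} {p e p' e' : α × Bool → K} {w : List (α × Bool)}
    (h : ∀ d ∈ w, p d = p' d ∧ e d = e' d) {s t : K} (hp : Path p e s w t) :
    Path p' e' s w t := by
  induction w generalizing s with
  | nil => exact hp
  | cons d w ih =>
    have h1 := h d (by simp)
    refine ⟨h1.1 ▸ hp.1, ?_⟩
    rw [← h1.2]
    exact ih (fun d hd => h d (by simp [hd])) hp.2

theorem path_const {α K : Type} {p e : α × Bool → K} {w : List (α × Bool)} {s : K}
    (h : ∀ d ∈ w, p d = s ∧ e d = s) : Path p e s w s := by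
  induction w with
  | nil => rfl
  | cons d w ih =>
    have h1 := h d (by simp)
    refine ⟨h1.1, ?_⟩
    rw [h1.2]
    exact ih (fun d hd => h d (by simp [hd]))

theorem path_map {α K L : Type} {p e : α × Bool → K} {w : List (α × Bool)} {s t : K}
    (f : K → L) (h : Path p e s w t) : Path (f ∘ p) (f ∘ e) (f s) w (f t) := by
  induction w generalizing s with
  | nil => exact congrArg f h
  | cons d w ih => exact ⟨congrArg f h.1, ih h.2⟩

theorem path_prod {α K L : Type} {p e : α × Bool → K} {p' e' : α × Bool → L}
    {w : List (α × Bool)} {s t : K} {s' t' : L}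
    (h : Path p e s w t) (h' : Path p' e' s' w t') :
    Path (fun d => (p d, p' d)) (fun d => (e d, e' d)) (s, s') w (t, t') := by
  induction w generalizing s s' with
  | nil =>
    have h1 : s = t := h
    have h2 : s' = t' := h'
    subst h1; subst h2; rfl
  | cons d w ih => exact ⟨Prod.ext h.1 h'.1, ih h.2 h'.2⟩

theorem path_filter {α K : Type} {p e : α × Bool → K} {w : List (α × Bool)} {s t : K}
    (P : α × Bool → Bool) (hP : ∀ d, P d = false → p d = e d) (h : Path p e s w t) :
    Path p e s (w.filter P) t := by
  induction w generalizing s with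
  | nil => exact h
  | cons d w ih =>
    by_cases hd : P d = true
    · rw [List.filter_cons_of_pos hd]
      exact ⟨h.1, ih h.2⟩
    · rw [List.filter_cons_of_neg hd]
      have h2 := ih h.2
      rw [← hP d (by simpa using hd), h.1] at h2
      exact h2

/-- telescoping -/
theorem path_sum {α K : Type} {p e : α × Bool → K} {w : List (α × Bool)} {s t : K}
    (χ : K → ℤ) (h : Path p e s w t) :
    (w.map (fun d => χ (p d))).sum + χ t = χ s + (w.map (fun d => χ (e d))).sum := by
  induction w generalizing s with
  | nil =>
    have h1 : s = t := h
    simp [h1]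
  | cons d w ih =>
    have h2 := ih h.2
    have h1 : p d = s := h.1
    simp only [List.map_cons, List.sum_cons, h1]
    linarith

/-- The set of words `W` is consistently coloured by `c`. -/
def Col {α K : Type} (c : α × Bool → K) (W : List (List (α × Bool))) : Prop :=
  ∀ w ∈ W, ∃ s, Path c (fun d => c (inv d)) s w s

theorem col_of_closed {α : Type} (S : Set (α × Bool)) (hS : ∀ d ∈ S, inv d ∈ S)
    (W : List (List (α × Bool)))
    (hW : ∀ w ∈ W, (∀ d ∈ w, d ∈ S) ∨ (∀ d ∈ w, d ∉ S)) :
    Col (fun d => d ∈ S) W := by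
  intro w hw
  rcases hW w hw with h | h
  · refine ⟨True, path_const fun d hd => ?_⟩
    simp [h d hd, hS _ (h d hd)]
  · refine ⟨False, path_const fun d hd => ?_⟩
    have : inv d ∉ S := fun h' => h d hd (by simpa using hS _ h')
    simp [h d hd, this]

/-! ### Free group generalities -/

/-- `L` does not involve the letter `x`. -/
def Avoids {α : Type} (x : α) (L : FreeGroup α) : Prop :=
  ∀ f g : FreeGroup α →* FreeGroup α,
    (∀ y, y ≠ x → f (FreeGroup.of y) = g (FreeGroup.of y)) → f L = g L

theorem mk_cons {α : Type} (d : α × Bool) (w : List (α × Bool)) :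
    FreeGroup.mk (d :: w) = FreeGroup.mk [d] * FreeGroup.mk w := by
  rw [FreeGroup.mul_mk]; rfl

theorem mk_append {α : Type} (v w : List (α × Bool)) :
    FreeGroup.mk (v ++ w) = FreeGroup.mk v * FreeGroup.mk w := by
  rw [FreeGroup.mul_mk]

theorem mk_inv {α : Type} (d : α × Bool) :
    FreeGroup.mk [inv d] = (FreeGroup.mk [d])⁻¹ := by
  rw [FreeGroup.inv_mk]; rfl

theorem mk_false {α : Type} (x : α) : FreeGroup.mk [(x, false)] = (FreeGroup.of x)⁻¹ := by
  exact mk_inv (x, true)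

theorem hom_congr {α Q : Type} [Group Q] (f g : FreeGroup α →* Q) (w : List (α × Bool))
    (h : ∀ d ∈ w, f (FreeGroup.of d.1) = g (FreeGroup.of d.1)) :
    f (FreeGroup.mk w) = g (FreeGroup.mk w) := by
  induction w with
  | nil => simp [← FreeGroup.one_eq_mk]
  | cons d w ih =>
    rw [mk_cons, map_mul, map_mul, ih (fun d hd => h d (by simp [hd]))]
    congr 1
    have h1 := h d (by simp)
    rcases d with ⟨x, b⟩
    cases b
    · rw [mk_false, map_inv, map_inv, h1]
    · exact h1

theorem avoids_mk {α : Type} (x : α) (w : List (α × Bool)) (h : ∀ d ∈ w, d.1 ≠ x) :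
    Avoids x (FreeGroup.mk w) := fun f g hfg => hom_congr f g w fun d hd => hfg _ (h d hd)

theorem Avoids.mul {α : Type} {x : α} {L R : FreeGroup α} (hL : Avoids x L) (hR : Avoids x R) :
    Avoids x (L * R) := fun f g h => by rw [map_mul, map_mul, hL f g h, hR f g h]

theorem Avoids.inv {α : Type} {x : α} {L : FreeGroup α} (hL : Avoids x L) :
    Avoids x L⁻¹ := fun f g h => by rw [map_inv, map_inv, hL f g h]

theorem Avoids.fix {α : Type} {x : α} {L : FreeGroup α} (hL : Avoids x L)
    (f : FreeGroup α →* FreeGroup α) (h : ∀ y, y ≠ x → f (FreeGroup.of y) = FreeGroup.of y) :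
    f L = L := hL f (MonoidHom.id _) h

theorem fix_mk {α : Type} (f : FreeGroup α →* FreeGroup α) (w : List (α × Bool))
    (h : ∀ d ∈ w, f (FreeGroup.of d.1) = FreeGroup.of d.1) :
    f (FreeGroup.mk w) = FreeGroup.mk w := hom_congr f (MonoidHom.id _) w h

theorem transv {α : Type} (d : α × Bool) (L R : FreeGroup α) (hL : Avoids d.1 L)
    (hR : Avoids d.1 R) :
    ∃ θ : FreeGroup α ≃* FreeGroup α, (∀ y, y ≠ d.1 → θ (FreeGroup.of y) = FreeGroup.of y) ∧
      θ (FreeGroup.mk [d]) = L * FreeGroup.of d.1 * R := by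
  classical
  rcases d with ⟨x, b⟩
  simp only at hL hR
  cases b
  · set f : FreeGroup α →* FreeGroup α :=
      FreeGroup.lift (fun y => if y = x then R⁻¹ * (FreeGroup.of x)⁻¹ * L⁻¹ else FreeGroup.of y) with hf
    set g : FreeGroup α →* FreeGroup α :=
      FreeGroup.lift (fun y => if y = x then L⁻¹ * (FreeGroup.of x)⁻¹ * R⁻¹ else FreeGroup.of y) with hg
    have f1 : ∀ y, y ≠ x → f (FreeGroup.of y) = FreeGroup.of y := fun y hy => by simp [hf, hy]
    have g1 : ∀ y, y ≠ x → g (FreeGroup.of y) = FreeGroup.of y := fun y hy => by simp [hg, hy]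
    have f2 : f (FreeGroup.of x) = R⁻¹ * (FreeGroup.of x)⁻¹ * L⁻¹ := by simp [hf]
    have g2 : g (FreeGroup.of x) = L⁻¹ * (FreeGroup.of x)⁻¹ * R⁻¹ := by simp [hg]
    refine ⟨MonoidHom.toMulEquiv f g ?_ ?_, f1, ?_⟩
    · ext y
      by_cases hy : y = x
      · subst hy
        simp [f2, g2, hL.fix g g1, hR.fix g g1, mul_assoc]
      · simp [f1 y hy, g1 y hy]
    · ext y
      by_cases hy : y = x
      · subst hy
        simp [f2, g2, hL.fix f f1, hR.fix f f1, mul_assoc]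
      · simp [f1 y hy, g1 y hy]
    · change f (FreeGroup.mk [(x, false)]) = L * FreeGroup.of x * R
      rw [mk_false, map_inv, f2]; group
  · set f : FreeGroup α →* FreeGroup α :=
      FreeGroup.lift (fun y => if y = x then L * (FreeGroup.of x) * R else FreeGroup.of y) with hf
    set g : FreeGroup α →* FreeGroup α :=
      FreeGroup.lift (fun y => if y = x then L⁻¹ * (FreeGroup.of x) * R⁻¹ else FreeGroup.of y) with hg
    have f1 : ∀ y, y ≠ x → f (FreeGroup.of y) = FreeGroup.of y := fun y hy => by simp [hf, hy]
    have g1 : ∀ y, y ≠ x → g (FreeGroup.of y) = FreeGroup.of y := fun y hy => by simp [hg, hy]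
    have f2 : f (FreeGroup.of x) = L * (FreeGroup.of x) * R := by simp [hf]
    have g2 : g (FreeGroup.of x) = L⁻¹ * (FreeGroup.of x) * R⁻¹ := by simp [hg]
    refine ⟨MonoidHom.toMulEquiv f g ?_ ?_, f1, ?_⟩
    · ext y
      by_cases hy : y = x
      · subst hy
        simp [f2, g2, hL.fix g g1, hR.fix g g1, mul_assoc]
      · simp [f1 y hy, g1 y hy]
    · ext y
      by_cases hy : y = x
      · subst hy
        simp [f2, g2, hL.fix f f1, hR.fix f f1, mul_assoc]
      · simp [f1 y hy, g1 y hy]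
    · exact f2

theorem presEquiv {α β : Type} (θ : FreeGroup α ≃* FreeGroup β) (R : Set (FreeGroup α))
    (S : Set (FreeGroup β))
    (h : ∀ (Q : Type) [Group Q] (f : FreeGroup β →* Q),
      (∀ r ∈ R, f (θ r) = 1) ↔ (∀ r ∈ S, f r = 1)) :
    Nonempty (PresentedGroup R ≃* PresentedGroup S) := by
  refine ⟨QuotientGroup.congr _ _ θ ?_⟩
  rw [Subgroup.map_normalClosure _ _ θ.surjective]
  apply le_antisymm
  · apply Subgroup.normalClosure_le_normal
    rintro _ ⟨r, hr, rfl⟩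
    have := (h _ (QuotientGroup.mk' (Subgroup.normalClosure S))).2
      (fun r hr => (QuotientGroup.eq_one_iff _).2 (Subgroup.subset_normalClosure hr)) r hr
    exact (QuotientGroup.eq_one_iff _).1 this
  · apply Subgroup.normalClosure_le_normal
    have := (h _ (QuotientGroup.mk' (Subgroup.normalClosure (θ.toMonoidHom '' R)))).1
      (fun r hr => (QuotientGroup.eq_one_iff _).2 (Subgroup.subset_normalClosure ⟨r, hr, rfl⟩))
    intro r hr
    exact (QuotientGroup.eq_one_iff _).1 (this r hr)


/-! ### One word -/

theorem one_word {α : Type} (n : ℕ) : ∀ w : List (α × Bool), w.length ≤ n → w.Nodup →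
    (∀ d ∈ w, inv d ∈ w) →
    (∀ c : α × Bool → Prop, Col c [w] → ∀ d ∈ w, ∀ d' ∈ w, c d → c d') →
    ∃ h, w.length = 4 * h ∧ ∃ z : Fin h × Bool → α, Function.Injective z ∧
      (∀ x, (x, true) ∈ w ↔ x ∈ Set.range z) ∧
      ∃ θ : FreeGroup α ≃* FreeGroup α,
        (∀ y, (y, true) ∉ w → θ (FreeGroup.of y) = FreeGroup.of y) ∧
        θ (FreeGroup.mk w) = (List.ofFn fun i : Fin h =>
          ⁅FreeGroup.of (z (i, true)), FreeGroup.of (z (i, false))⁆).prod := by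
  classical
  induction n with
  | zero =>
    intro w hw _ _ _
    have : w = [] := by simpa using hw
    subst this
    refine ⟨0, rfl, fun i => i.1.elim0, fun i => i.1.elim0, fun x => ?_, MulEquiv.refl _, fun _ _ => rfl, ?_⟩
    · simp
    · simp [← FreeGroup.one_eq_mk]
  | succ n ih =>
    intro w hw hnd hcl hconn
    rcases w with _ | ⟨a, w1⟩
    · exact ih [] (by simp) hnd hcl hconn
    have ha : inv a ∈ w1 := by
      have := hcl a (by simp)
      simpa [inv_ne] using this
    obtain ⟨m, y0, rfl⟩ := List.append_of_mem ha
    have hb : ∃ b ∈ m, inv b ∉ m := by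
      by_contra hcon
      push Not at hcon
      have hnd' := hnd
      simp only [List.nodup_cons, List.nodup_append, List.mem_append, List.mem_cons] at hnd'
      let c : α × Bool → Prop := fun d => d ∈ m ∨ d = inv a
      have h1 : Col c [a :: (m ++ inv a :: y0)] := by
        intro w hw
        simp only [List.mem_singleton] at hw
        subst hw
        have hca : c a = False := by
          simp only [c, eq_iff_iff, iff_false, not_or]
          exact ⟨fun h => hnd'.1 (Or.inl h), fun h => inv_ne a h.symm⟩
        have hca' : c (inv a) = True := by simp [c]
        refine ⟨False, hca, ?_⟩
        rw [path_append]
        refine ⟨True, ?_, ?_⟩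
        · beta_reduce
          rw [hca']
          apply path_const
          intro d hd
          simp [c, hd, hcon d hd]
        · refine ⟨hca', ?_⟩
          simp only [inv_inv, hca]
          apply path_const
          intro d hd
          have hdm : d ∉ m := fun h => hnd'.2.2.2 d h d (Or.inr hd) rfl
          have hda : d ≠ inv a := fun h => hnd'.2.2.1.1 (h ▸ hd)
          have hda' : d ≠ a := fun h => hnd'.1 (Or.inr (Or.inr (h ▸ hd)))
          have h2 : inv d ∉ m := fun h => hdm (by simpa using hcon _ h)
          have h3 : inv d ≠ inv a := fun h => hda' (inv_inj h)
          simp [c, hdm, hda, h2, h3]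
      have h2 := hconn c h1 (inv a) (by simp) a (by simp) (by simp [c])
      rcases h2 with h2 | h2
      · exact hnd'.1 (Or.inl h2)
      · exact inv_ne a h2.symm
    obtain ⟨b, hbm, hbi⟩ := hb
    obtain ⟨u, v, rfl⟩ := List.append_of_mem hbm
    have hby : inv b ∈ y0 := by
      have h1 := hcl b (by simp)
      simp only [List.mem_cons, List.mem_append] at h1 hbi
      rcases h1 with h1 | h1 | h1 | h1
      · exfalso
        have : b = inv a := by rw [← h1, inv_inv]
        subst this
        simp [List.nodup_append] at hnd
      · exact absurd h1 hbi
      · have := inv_inj h1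
        subst this
        simp at hnd
      · exact h1
    obtain ⟨x, y, rfl⟩ := List.append_of_mem hby
    -- the reduced word
    have hab : a.1 ≠ b.1 := by
      intro h
      rcases fst_eq h with h | h
      · subst h; simp at hnd
      · subst h; simp at hnd
    have hrest : ∀ d ∈ x ++ v ++ u ++ y, d.1 ≠ a.1 ∧ d.1 ≠ b.1 := by
      intro d hd
      simp only [List.nodup_cons, List.nodup_append, List.mem_append, List.mem_cons] at hnd hd
      constructor
      · intro h
        rcases fst_eq h with h | h <;> subst h <;> grind
      · intro h
        rcases fst_eq h with h | h <;> subst h <;> grind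
    have hmem : ∀ d, d ∈ a :: (u ++ b :: v ++ inv a :: (x ++ inv b :: y)) ↔
        d ∈ x ++ v ++ u ++ y ∨ d.1 = a.1 ∨ d.1 = b.1 := by
      intro d
      constructor
      · intro h
        simp only [List.mem_append, List.mem_cons] at h ⊢
        rcases h with h | (h | h | h) | h | h | h | h <;> simp [h]
      · intro h
        rcases h with h | h | h
        · simp only [List.mem_append, List.mem_cons] at h ⊢
          tauto
        · rcases fst_eq h with h | h <;> subst h <;> simp
        · rcases fst_eq h with h | h <;> subst h <;> simp
    have hnd2 : (x ++ v ++ u ++ y).Nodup := by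
      have hperm : (a :: (u ++ b :: v ++ inv a :: (x ++ inv b :: y))).Perm
          (a :: inv a :: b :: inv b :: (x ++ v ++ u ++ y)) := by
        rw [List.perm_iff_count]
        intro t
        simp only [List.count_append, List.count_cons]
        omega
      have := hperm.nodup_iff.1 hnd
      simp only [List.nodup_cons] at this
      exact this.2.2.2.2
    obtain ⟨h, hlen, z, hz, hzr, θ, hθ, hθw⟩ := ih (x ++ v ++ u ++ y) (by
        simp only [List.length_cons, List.length_append] at hw ⊢; omega) hnd2 (by
        intro d hd
        have h1 := hrest d hd
        have h2 := (hmem (inv d)).1 (hcl d ((hmem d).2 (Or.inl hd)))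
        rcases h2 with h2 | h2 | h2
        · exact h2
        · exact absurd h2 h1.1
        · exact absurd h2 h1.2) (by
        intro c hc d hd d' hd' hcd
        obtain ⟨s, hs⟩ := hc _ (List.mem_singleton.2 rfl)
        rw [path_append, ] at hs
        obtain ⟨δ, hs, hy⟩ := hs
        rw [path_append, ] at hs
        obtain ⟨γ, hs, hu⟩ := hs
        rw [path_append, ] at hs
        obtain ⟨β, hx, hv⟩ := hs
        let c' : α × Bool → Prop := fun d => if d = a then s else if d = inv a then γ else
          if d = b then δ else if d = inv b then β else c d
        have hba : b ≠ a := fun h => hab (by rw [h])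
        have hba' : b ≠ inv a := fun h => hab (by rw [h]; rfl)
        have hba1 : inv b ≠ a := fun h => hab (by rw [← h]; rfl)
        have hba1' : inv b ≠ inv a := fun h => hba (inv_inj h)
        have ca : c' a = s := by simp [c']
        have ca' : c' (inv a) = γ := by simp [c', inv_ne]
        have cb : c' b = δ := by simp [c', hba, hba']
        have cb' : c' (inv b) = β := by simp [c', hba1, hba1', inv_ne]
        have cc : ∀ d, d.1 ≠ a.1 ∧ d.1 ≠ b.1 → c' d = c d := by
          intro d hd
          have h1 : d ≠ a := fun h => hd.1 (by rw [h])
          have h2 : d ≠ inv a := fun h => hd.1 (by rw [h]; rfl)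
          have h3 : d ≠ b := fun h => hd.2 (by rw [h])
          have h4 : d ≠ inv b := fun h => hd.2 (by rw [h]; rfl)
          simp [c', h1, h2, h3, h4]
        have tr : ∀ (l : List (α × Bool)), (∀ d ∈ l, d ∈ x ++ v ++ u ++ y) → ∀ s t,
            Path c (fun d => c (inv d)) s l t → Path c' (fun d => c' (inv d)) s l t := by
          intro l hl s t
          apply path_congr
          intro d hd
          have := hrest d (hl d hd)
          exact ⟨(cc d this).symm, (cc (inv d) this).symm⟩
        have hc' : Col c' [a :: (u ++ b :: v ++ inv a :: (x ++ inv b :: y))] := by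
          intro w hw
          simp only [List.mem_singleton] at hw
          subst hw
          refine ⟨s, ca, ?_⟩
          beta_reduce
          rw [ca', path_append]
          refine ⟨γ, ?_, ca', ?_⟩
          · rw [path_append]
            refine ⟨δ, tr u (by simp +contextual) _ _ hu, cb, ?_⟩
            beta_reduce
            rw [cb']
            exact tr v (by simp +contextual) _ _ hv
          · beta_reduce
            rw [inv_inv, ca, path_append]
            refine ⟨β, tr x (by simp +contextual) _ _ hx, cb', ?_⟩
            beta_reduce
            rw [inv_inv, cb]
            exact tr y (by simp +contextual) _ _ hy
        have := hconn c' hc' d ((hmem d).2 (Or.inl hd)) d' ((hmem d').2 (Or.inl hd'))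
        rw [cc d (hrest d hd), cc d' (hrest d' hd')] at this
        exact this hcd)
    have hav : ∀ (l : List (α × Bool)), (∀ d ∈ l, d ∈ x ++ v ++ u ++ y) →
        Avoids a.1 (FreeGroup.mk l) ∧ Avoids b.1 (FreeGroup.mk l) := fun l hl =>
      ⟨avoids_mk _ _ fun d hd => (hrest d (hl d hd)).1,
        avoids_mk _ _ fun d hd => (hrest d (hl d hd)).2⟩
    have hx := hav x (by simp +contextual)
    have hy := hav y (by simp +contextual)
    have hu := hav u (by simp +contextual)
    have hv := hav v (by simp +contextual)
    obtain ⟨ta, ta1, ta2⟩ := transv a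
      (FreeGroup.mk x * FreeGroup.mk v * FreeGroup.mk u * FreeGroup.mk y)
      ((FreeGroup.mk u * FreeGroup.mk y)⁻¹) (((hx.1.mul hv.1).mul hu.1).mul hy.1)
      (hu.1.mul hy.1).inv
    obtain ⟨tb, tb1, tb2⟩ := transv b
      (FreeGroup.mk y)
      ((FreeGroup.mk y)⁻¹ * (FreeGroup.mk u)⁻¹ * (FreeGroup.mk v)⁻¹) hy.2
      ((hy.2.inv.mul hu.2.inv).mul hv.2.inv)
    have fixa : ∀ L, Avoids a.1 L → ta L = L := fun L hL => hL.fix ta.toMonoidHom ta1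
    have fixb : ∀ L, Avoids b.1 L → tb L = L := fun L hL => hL.fix tb.toMonoidHom tb1
    have e1 : ta (FreeGroup.mk [b]) = FreeGroup.mk [b] :=
      fixa _ (avoids_mk _ _ (by simpa using hab.symm))
    have e2 : tb (FreeGroup.of a.1) = FreeGroup.of a.1 := tb1 _ hab
    have key : tb (ta (FreeGroup.mk (a :: (u ++ b :: v ++ inv a :: (x ++ inv b :: y))))) =
        FreeGroup.mk (x ++ v ++ u ++ y) * ⁅FreeGroup.of a.1, FreeGroup.of b.1⁆ := by
      rw [mk_cons, mk_append, mk_append, mk_cons b, mk_cons (inv a), mk_append, mk_cons (inv b),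
        mk_inv, mk_inv, mk_append, mk_append, mk_append]
      simp only [map_mul, map_inv, ta2, e1, e2, tb2, fixa _ hx.1, fixa _ hy.1, fixa _ hu.1,
        fixa _ hv.1, fixb _ hx.2, fixb _ hy.2, fixb _ hu.2, fixb _ hv.2]
      rw [commutatorElement_def]
      group
    have hna : (a.1, true) ∉ x ++ v ++ u ++ y := fun h => (hrest _ h).1 rfl
    have hnb : (b.1, true) ∉ x ++ v ++ u ++ y := fun h => (hrest _ h).2 rfl
    have hza : ∀ i, z i ≠ a.1 := fun i h => hna ((hzr _).2 ⟨i, h⟩)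
    have hzb : ∀ i, z i ≠ b.1 := fun i h => hnb ((hzr _).2 ⟨i, h⟩)
    let z' : Fin (h + 1) × Bool → α := fun p =>
      Fin.snoc (α := fun _ => α) (fun i => z (i, p.2)) (if p.2 then a.1 else b.1) p.1
    have z1 : ∀ (i : Fin h) β, z' (i.castSucc, β) = z (i, β) := fun i β => by simp [z']
    have z2 : z' (Fin.last h, true) = a.1 := by simp [z']
    have z3 : z' (Fin.last h, false) = b.1 := by simp [z']
    refine ⟨h + 1, ?_, z', ?_, ?_, (ta.trans tb).trans θ, ?_, ?_⟩
    · simp only [List.length_cons, List.length_append] at hlen ⊢; omega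
    · rintro ⟨i, β⟩ ⟨j, γ⟩ hij
      induction i using Fin.lastCases with
      | last =>
        induction j using Fin.lastCases with
        | last =>
          cases β <;> cases γ <;> simp only [z2, z3] at hij
          · rfl
          · exact absurd hij.symm hab
          · exact absurd hij hab
          · rfl
        | cast j =>
          rw [z1] at hij
          cases β <;> simp only [z2, z3] at hij
          · exact absurd hij.symm (hzb _)
          · exact absurd hij.symm (hza _)
      | cast i =>
        induction j using Fin.lastCases with
        | last =>
          rw [z1] at hij
          cases γ <;> simp only [z2, z3] at hij
          · exact absurd hij (hzb _)
          · exact absurd hij (hza _)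
        | cast j =>
          rw [z1, z1] at hij
          have := hz hij
          simp only [Prod.mk.injEq] at this
          rw [this.1, this.2]
    · intro t
      rw [hmem, hzr]
      constructor
      · rintro (⟨⟨i, β⟩, hi⟩ | hi | hi)
        · exact ⟨(i.castSucc, β), by rw [z1, hi]⟩
        · exact ⟨_, z2.trans hi.symm⟩
        · exact ⟨_, z3.trans hi.symm⟩
      · rintro ⟨⟨i, β⟩, hi⟩
        induction i using Fin.lastCases with
        | last =>
          cases β <;> simp only [z2, z3] at hi
          · exact Or.inr (Or.inr hi.symm)
          · exact Or.inr (Or.inl hi.symm)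
        | cast i =>
          rw [z1] at hi
          exact Or.inl ⟨_, hi⟩
    · intro t ht
      rw [hmem] at ht
      push Not at ht
      simp only [MulEquiv.trans_apply]
      rw [ta1 _ ht.2.1, tb1 _ ht.2.2, hθ _ ht.1]
    · simp only [MulEquiv.trans_apply]
      rw [key, map_mul, hθw, List.ofFn_succ', List.concat_eq_append, List.prod_append]
      simp only [z1, z2, z3, List.prod_singleton]
      rw [map_commutatorElement, hθ _ hna, hθ _ hnb]


/-! ### Several words, one vertex -/

/-- Relators: the words of `W`, together with all letters not used in `W`. -/
def rels {α : Type} (W : List (List (α × Bool))) : Set (FreeGroup α) :=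
  {r | (∃ w ∈ W, r = FreeGroup.mk w) ∨ ∃ x, (x, true) ∉ W.flatten ∧ r = FreeGroup.of x}

theorem killsRels {α Q : Type} [Group Q] (W : List (List (α × Bool))) (f : FreeGroup α → Q) :
    (∀ r ∈ rels W, f r = 1) ↔ (∀ w ∈ W, f (FreeGroup.mk w) = 1) ∧
      ∀ x, (x, true) ∉ W.flatten → f (FreeGroup.of x) = 1 := by
  constructor
  · intro h
    exact ⟨fun w hw => h _ (Or.inl ⟨w, hw, rfl⟩), fun x hx => h _ (Or.inr ⟨x, hx, rfl⟩)⟩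
  · rintro ⟨h1, h2⟩ r (⟨w, hw, rfl⟩ | ⟨x, hx, rfl⟩)
    · exact h1 w hw
    · exact h2 x hx

theorem pres_inj {α β : Type} (z : β → α) (hz : Function.Injective z) (S : Set (FreeGroup β))
    (R : Set (FreeGroup α)) (hR : R = FreeGroup.map z '' S ∪ {r | ∃ x, x ∉ Set.range z ∧ r = FreeGroup.of x}) :
    Nonempty (PresentedGroup R ≃* PresentedGroup S) := by
  classical
  let f : α → PresentedGroup S := fun x =>
    if h : ∃ b, z b = x then PresentedGroup.of h.choose else 1
  have f1 : ∀ b, f (z b) = PresentedGroup.of b := by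
    intro b
    have h : ∃ b', z b' = z b := ⟨b, rfl⟩
    have h2 : h.choose = b := hz h.choose_spec
    simp only [f, dif_pos h, h2]
  have f2 : ∀ x, x ∉ Set.range z → f x = 1 := by
    intro x hx
    have : ¬ ∃ b, z b = x := hx
    simp only [f, dif_neg this]
  have f3 : (FreeGroup.lift f).comp (FreeGroup.map z) = PresentedGroup.mk S := by
    ext b
    simp [f1, PresentedGroup.of]
  have f4 : ∀ r ∈ R, FreeGroup.lift f r = 1 := by
    rw [hR]
    rintro r (⟨s, hs, rfl⟩ | ⟨x, hx, rfl⟩)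
    · have := DFunLike.congr_fun f3 s
      simp only [MonoidHom.comp_apply] at this
      rw [this]
      exact PresentedGroup.one_of_mem hs
    · simp [f2 x hx]
  have g3 : FreeGroup.lift (fun b => (PresentedGroup.of (z b) : PresentedGroup R)) =
      (PresentedGroup.mk R).comp (FreeGroup.map z) := by
    ext b
    simp [PresentedGroup.of]
  have g4 : ∀ s ∈ S, FreeGroup.lift (fun b => (PresentedGroup.of (z b) : PresentedGroup R)) s = 1 := by
    intro s hs
    rw [g3]
    apply PresentedGroup.one_of_mem
    rw [hR]
    exact Or.inl ⟨s, hs, rfl⟩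
  refine ⟨MonoidHom.toMulEquiv (PresentedGroup.toGroup f4) (PresentedGroup.toGroup g4) ?_ ?_⟩
  · ext x
    by_cases hx : x ∈ Set.range z
    · obtain ⟨b, rfl⟩ := hx
      simp [f1]
    · simp only [MonoidHom.comp_apply, PresentedGroup.toGroup.of, f2 x hx, map_one, MonoidHom.id_apply]
      symm
      apply PresentedGroup.one_of_mem
      rw [hR]
      exact Or.inr ⟨x, hx, rfl⟩
  · ext b
    simp [f1]

theorem one_word_surface {α : Type} (w : List (α × Bool)) (h : ℕ) (hlen : w.length = 4 * h)
    (hnd : w.Nodup) (hcl : ∀ d ∈ w, inv d ∈ w)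
    (hconn : ∀ c : α × Bool → Prop, Col c [w] → ∀ d ∈ w, ∀ d' ∈ w, c d → c d') :
    Nonempty (PresentedGroup (rels [w]) ≃* SurfaceGroup h) := by
  obtain ⟨h', hlen', z, hz, hzr, θ, hθ, hθw⟩ := one_word w.length w le_rfl hnd hcl hconn
  have : h' = h := by omega
  subst this
  obtain ⟨e1⟩ := pres_inj z hz {surfaceRelator h'} _ rfl
  obtain ⟨e2⟩ := presEquiv θ (rels [w]) (FreeGroup.map z '' {surfaceRelator h'} ∪
      {r | ∃ x, x ∉ Set.range z ∧ r = FreeGroup.of x}) (by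
    intro Q _ f
    have hs : FreeGroup.map z (surfaceRelator h') = θ (FreeGroup.mk w) := by
      rw [hθw, surfaceRelator, map_list_prod, List.map_ofFn]
      congr 2
    rw [killsRels [w] (fun r => f (θ r))]
    constructor
    · rintro ⟨h1, h2⟩ r (⟨s, hs', rfl⟩ | ⟨x, hx, rfl⟩)
      · rw [Set.mem_singleton_iff] at hs'
        rw [hs', hs]
        exact h1 w (by simp)
      · rw [← hzr] at hx
        have := h2 x (by simpa using hx)
        rwa [hθ x hx] at this
    · intro h1
      refine ⟨?_, ?_⟩
      · intro w' hw'
        rw [List.mem_singleton] at hw'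
        subst hw'
        rw [← hs]
        exact h1 _ (Or.inl ⟨_, rfl, rfl⟩)
      · intro x hx
        have hx' : (x, true) ∉ w := by simpa using hx
        rw [hθ x hx']
        exact h1 _ (Or.inr ⟨x, by rwa [← hzr], rfl⟩))
  exact ⟨e2.trans e1⟩

theorem mem_true_iff {α : Type} {l : List (α × Bool)} (hcl : ∀ d ∈ l, inv d ∈ l) (d : α × Bool) :
    (d.1, true) ∈ l ↔ d ∈ l := by
  rcases d with ⟨x, b⟩
  cases b
  · exact ⟨fun h => hcl _ h, fun h => hcl _ h⟩
  · rfl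

theorem merge_words {α : Type} (n : ℕ) : ∀ (W : List (List (α × Bool))) (h : ℕ), W.length = n →
    1 ≤ h → W.flatten.Nodup → (∀ d ∈ W.flatten, inv d ∈ W.flatten) →
    (∀ c : α × Bool → Prop, Col c W → ∀ d ∈ W.flatten, ∀ d' ∈ W.flatten, c d → c d') →
    (∀ w ∈ W, w ≠ []) → W.flatten.length + 2 = 4 * h + 2 * n →
    Nonempty (PresentedGroup (rels W) ≃* SurfaceGroup h) := by
  classical
  induction n with
  | zero =>
    intro W h hW hh _ _ _ _ hE
    have : W = [] := by simpa using hW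
    subst this
    simp at hE
    omega
  | succ n ih =>
    intro W h hW hh hnd hcl hconn hne hE
    rcases W with _ | ⟨w1, W1⟩
    · simp at hW
    by_cases hc1 : ∀ d ∈ w1, inv d ∈ w1
    · -- a closed word is the only word
      have hW1 : W1 = [] := by
        by_contra hW1
        obtain ⟨w2, hw2⟩ := List.exists_mem_of_ne_nil _ hW1
        obtain ⟨d2, hd2⟩ := List.exists_mem_of_ne_nil _ (hne w2 (by simp [hw2]))
        obtain ⟨d1, hd1⟩ := List.exists_mem_of_ne_nil _ (hne w1 (by simp))
        have hdis : ∀ w ∈ W1, ∀ d ∈ w, d ∉ w1 := by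
          intro w hw d hd hd'
          rw [List.flatten_cons, List.nodup_append] at hnd
          exact hnd.2.2 d hd' d (List.mem_flatten.2 ⟨w, hw, hd⟩) rfl
        have hcol : Col (fun d => d ∈ {d | d ∈ w1}) (w1 :: W1) := by
          apply col_of_closed
          · exact hc1
          · intro w hw
            rcases List.mem_cons.1 hw with rfl | hw
            · exact Or.inl fun d hd => hd
            · exact Or.inr fun d hd => hdis w hw d hd
        have := hconn _ hcol d1 (by simp [hd1]) d2 (List.mem_flatten.2 ⟨w2, by simp [hw2], hd2⟩) hd1
        exact hdis w2 hw2 d2 hd2 this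
      subst hW1
      simp only [List.length_cons, List.length_nil] at hW
      simp only [List.flatten_cons, List.flatten_nil, List.append_nil] at hnd hcl hconn hE
      exact one_word_surface w1 h (by omega) hnd hcl hconn
    · push Not at hc1
      obtain ⟨a, ha, hia⟩ := hc1
      have hia' : inv a ∈ W1.flatten := by
        have := hcl a (by simp [ha])
        rw [List.flatten_cons, List.mem_append] at this
        exact this.resolve_left hia
      obtain ⟨w2, hw2, hia2⟩ := List.mem_flatten.1 hia'
      obtain ⟨p, q, rfl⟩ := List.append_of_mem ha
      obtain ⟨p', q', rfl⟩ := List.append_of_mem hia2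
      obtain ⟨X, Y, rfl⟩ := List.append_of_mem hw2
      -- the new system
      have hperm : ((p ++ a :: q) :: (X ++ (p' ++ inv a :: q') :: Y)).flatten.Perm
          (a :: inv a :: ((q' ++ p' ++ q ++ p) :: (X ++ Y)).flatten) := by
        rw [List.perm_iff_count]
        intro t
        simp only [List.flatten_cons, List.flatten_append, List.count_append, List.count_cons]
        omega
      set L := ((q' ++ p' ++ q ++ p) :: (X ++ Y)).flatten with hL
      have hmemW : ∀ d, d ∈ ((p ++ a :: q) :: (X ++ (p' ++ inv a :: q') :: Y)).flatten ↔
          d.1 = a.1 ∨ d ∈ L := by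
        intro d
        rw [hperm.mem_iff, List.mem_cons, List.mem_cons, ← or_assoc]
        refine or_congr_left ⟨?_, fst_eq⟩
        rintro (rfl | rfl) <;> rfl
      have hndL := hperm.nodup_iff.1 hnd
      simp only [List.nodup_cons] at hndL
      have hLa : ∀ d ∈ L, d.1 ≠ a.1 := by
        intro d hd hda
        rcases fst_eq hda with rfl | rfl
        · exact hndL.1 (by simp [hd])
        · exact hndL.2.1 hd
      have hclL : ∀ d ∈ L, inv d ∈ L := by
        intro d hd
        have := (hmemW _).1 (hcl d ((hmemW d).2 (Or.inr hd)))
        exact this.resolve_left (hLa d hd)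
      have hinL : ∀ w ∈ (q' ++ p' ++ q ++ p) :: (X ++ Y), ∀ d ∈ w, d ∈ L := fun w hw d hd =>
        List.mem_flatten.2 ⟨w, hw, hd⟩
      have hlenL := hperm.length_eq
      have hXY : ∀ w ∈ X ++ Y, w ∈ (p ++ a :: q) :: (X ++ (p' ++ inv a :: q') :: Y) := by
        intro w hw
        simp only [List.mem_append, List.mem_cons] at hw ⊢
        tauto
      have hlW : (X ++ Y).length + 1 = n := by
        simp only [List.length_cons, List.length_append] at hW ⊢; omega
      simp only [List.length_cons] at hlenL
      obtain ⟨e1⟩ := ih ((q' ++ p' ++ q ++ p) :: (X ++ Y)) h (by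
          simpa using hlW) hh hndL.2.2 hclL (by
          intro c hc d hd d' hd' hcd
          obtain ⟨s, hs⟩ := hc _ (List.mem_cons_self)
          rw [path_append] at hs
          obtain ⟨m3, hs, hp⟩ := hs
          rw [path_append] at hs
          obtain ⟨m2, hs, hq⟩ := hs
          rw [path_append] at hs
          obtain ⟨m1, hq', hp'⟩ := hs
          let c' : α × Bool → Prop := fun d => if d = a then s else if d = inv a then m2 else c d
          have ca : c' a = s := by simp [c']
          have ca' : c' (inv a) = m2 := by simp [c', inv_ne]
          have cc : ∀ d, d.1 ≠ a.1 → c' d = c d := by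
            intro d hd
            have h1 : d ≠ a := fun h => hd (by rw [h])
            have h2 : d ≠ inv a := fun h => hd (by rw [h]; rfl)
            simp [c', h1, h2]
          have tr : ∀ (l : List (α × Bool)), (∀ d ∈ l, d ∈ L) → ∀ s t,
              Path c (fun d => c (inv d)) s l t → Path c' (fun d => c' (inv d)) s l t := by
            intro l hl s t
            apply path_congr
            intro d hd
            have := hLa d (hl d hd)
            exact ⟨(cc d this).symm, (cc (inv d) this).symm⟩
          have hc' : Col c' ((p ++ a :: q) :: (X ++ (p' ++ inv a :: q') :: Y)) := by
            intro w hw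
            by_cases hw1 : w = p ++ a :: q
            · subst hw1
              refine ⟨m3, ?_⟩
              rw [path_append]
              refine ⟨s, tr p (fun d hd => hinL _ List.mem_cons_self d (by simp [hd])) _ _ hp, ca, ?_⟩
              beta_reduce
              rw [ca']
              exact tr q (fun d hd => hinL _ List.mem_cons_self d (by simp [hd])) _ _ hq
            by_cases hw2 : w = p' ++ inv a :: q'
            · subst hw2
              refine ⟨m1, ?_⟩
              rw [path_append]
              refine ⟨m2, tr p' (fun d hd => hinL _ List.mem_cons_self d (by simp [hd])) _ _ hp', ca', ?_⟩
              beta_reduce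
              rw [inv_inv, ca]
              exact tr q' (fun d hd => hinL _ List.mem_cons_self d (by simp [hd])) _ _ hq'
            have hw3 : w ∈ X ++ Y := by
              simp only [List.mem_append, List.mem_cons] at hw ⊢
              tauto
            obtain ⟨t, ht⟩ := hc w (by rw [List.mem_cons]; exact Or.inr hw3)
            exact ⟨t, tr w (hinL w (by rw [List.mem_cons]; exact Or.inr hw3)) _ _ ht⟩
          have := hconn c' hc' d ((hmemW d).2 (Or.inr hd)) d' ((hmemW d').2 (Or.inr hd'))
          rw [cc d (hLa d hd), cc d' (hLa d' hd')] at this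
          exact this hcd) (by
          intro w hw
          rcases List.mem_cons.1 hw with rfl | hw
          · intro hemp
            simp only [List.append_eq_nil_iff] at hemp
            obtain ⟨⟨⟨rfl, rfl⟩, rfl⟩, rfl⟩ := hemp
            have hcol : Col (fun d => d ∈ {d | d.1 = a.1}) (([] ++ a :: []) :: (X ++ ([] ++ inv a :: []) :: Y)) := by
              apply col_of_closed
              · intro d hd; exact hd
              · intro w hw
                by_cases hw1 : w = [a]
                · subst hw1
                  exact Or.inl (by simp)
                by_cases hw2 : w = [inv a]
                · subst hw2
                  exact Or.inl (by simp)
                have hw3 : w ∈ X ++ Y := by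
                  simp only [List.mem_append, List.mem_cons, List.nil_append] at hw ⊢
                  tauto
                exact Or.inr fun d hd => hLa d (hinL w (by rw [List.mem_cons]; exact Or.inr hw3) d hd)
            have hXY0 : X ++ Y = [] := by
              by_contra h0
              obtain ⟨w, hw⟩ := List.exists_mem_of_ne_nil _ h0
              obtain ⟨d, hd⟩ := List.exists_mem_of_ne_nil _ (hne w (hXY w hw))
              have hdL := hinL w (by rw [List.mem_cons]; exact Or.inr hw) d hd
              have := hconn _ hcol a ((hmemW a).2 (Or.inl rfl)) d ((hmemW d).2 (Or.inr hdL)) rfl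
              exact hLa d hdL this
            have hL0 : L.length = 0 := by rw [hL, hXY0]; simp
            rw [hXY0] at hlW
            simp only [List.length_nil] at hlW
            omega
          · exact hne w (hXY w hw)) (by rw [← hL]; omega)
      -- the change of variables
      have hav : Avoids a.1 (FreeGroup.mk (q' ++ p')) := by
        apply avoids_mk
        intro d hd
        exact hLa d (hinL _ List.mem_cons_self d (by
          simp only [List.mem_append] at hd ⊢; tauto))
      obtain ⟨θ, θ1, θ2⟩ := transv a (FreeGroup.mk (q' ++ p')) 1 hav (by intro f g _; simp)
      have θL : ∀ l : List (α × Bool), (∀ d ∈ l, d ∈ L) → θ (FreeGroup.mk l) = FreeGroup.mk l := by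
        intro l hl
        exact fix_mk θ.toMonoidHom l fun d hd => θ1 _ (hLa d (hl d hd))
      have θp := θL p (fun d hd => hinL _ List.mem_cons_self d (by simp [hd]))
      have θq := θL q (fun d hd => hinL _ List.mem_cons_self d (by simp [hd]))
      have θp' := θL p' (fun d hd => hinL _ List.mem_cons_self d (by simp [hd]))
      have θq' := θL q' (fun d hd => hinL _ List.mem_cons_self d (by simp [hd]))
      have k1 : θ (FreeGroup.mk (p ++ a :: q)) = FreeGroup.mk p * (FreeGroup.mk q' * FreeGroup.mk p' *
          FreeGroup.of a.1) * FreeGroup.mk q := by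
        rw [mk_append, mk_cons, map_mul, map_mul, θp, θq, θ2, mk_append]
        group
      have k2 : θ (FreeGroup.mk (p' ++ inv a :: q')) = FreeGroup.mk p' * (FreeGroup.mk q' * FreeGroup.mk p' *
          FreeGroup.of a.1)⁻¹ * FreeGroup.mk q' := by
        rw [mk_append, mk_cons, mk_inv, map_mul, map_mul, map_inv, θp', θq', θ2, mk_append]
        group
      have haL : (a.1, true) ∉ L := fun h => hLa _ h rfl
      obtain ⟨e2⟩ := presEquiv θ (rels ((p ++ a :: q) :: (X ++ (p' ++ inv a :: q') :: Y)))
          (rels ((q' ++ p' ++ q ++ p) :: (X ++ Y))) (by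
        intro Q _ f
        rw [killsRels _ (fun r => f (θ r)), killsRels _ f]
        constructor
        · rintro ⟨h1, h2⟩
          have a1 := h1 (p ++ a :: q) (by simp)
          have a2 := h1 (p' ++ inv a :: q') (by simp)
          rw [k1] at a1
          rw [k2] at a2
          simp only [map_mul, map_inv] at a1 a2
          have a3 : f (FreeGroup.of a.1) = 1 := by
            have : f (FreeGroup.of a.1) = ((f (FreeGroup.mk p'))⁻¹ * (f (FreeGroup.mk p') * (f (FreeGroup.mk q') * f (FreeGroup.mk p') * f (FreeGroup.of a.1))⁻¹ * f (FreeGroup.mk q')) * f (FreeGroup.mk p'))⁻¹ := by group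
            rw [this, a2]; group
          refine ⟨?_, ?_⟩
          · intro w hw
            rcases List.mem_cons.1 hw with rfl | hw
            · rw [mk_append, mk_append, mk_append]
              simp only [map_mul]
              rw [a3] at a1
              calc _ = (f (FreeGroup.mk p))⁻¹ * (f (FreeGroup.mk p) * (f (FreeGroup.mk q') * f (FreeGroup.mk p') * 1) * f (FreeGroup.mk q)) * f (FreeGroup.mk p) := by group
                _ = 1 := by rw [a1]; group
            · have := h1 w (hXY w hw)
              rwa [θL w (hinL w (by rw [List.mem_cons]; exact Or.inr hw))] at this
          · intro x hx
            by_cases hxa : x = a.1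
            · rw [hxa, a3]
            · have := h2 x (by
                rw [hmemW]
                push Not
                exact ⟨hxa, hx⟩)
              rwa [θ1 x hxa] at this
        · rintro ⟨h1, h2⟩
          have a3 := h2 a.1 haL
          have a1 := h1 _ List.mem_cons_self
          rw [mk_append, mk_append, mk_append] at a1
          simp only [map_mul] at a1
          refine ⟨?_, ?_⟩
          · intro w hw
            by_cases hw1 : w = p ++ a :: q
            · subst hw1
              rw [k1]
              simp only [map_mul, a3]
              calc _ = f (FreeGroup.mk p) * (f (FreeGroup.mk q') * f (FreeGroup.mk p') * f (FreeGroup.mk q) * f (FreeGroup.mk p)) * (f (FreeGroup.mk p))⁻¹ := by group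
                _ = 1 := by rw [a1]; group
            by_cases hw2 : w = p' ++ inv a :: q'
            · subst hw2
              rw [k2]
              simp only [map_mul, map_inv, a3]
              group
            have hw3 : w ∈ X ++ Y := by
              simp only [List.mem_append, List.mem_cons] at hw ⊢
              tauto
            have hw4 : w ∈ (q' ++ p' ++ q ++ p) :: (X ++ Y) := by
              rw [List.mem_cons]; exact Or.inr hw3
            rw [θL w (hinL w hw4)]
            exact h1 w hw4
          · intro x hx
            rw [hmemW] at hx
            push Not at hx
            rw [θ1 x hx.1]
            exact h2 x hx.2)
      exact ⟨e2.trans e1⟩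


/-! ### Contracting edges -/

theorem reinsert {α K : Type} [DecidableEq α] (z : α × Bool) (w : List (α × Bool))
    (hnd : w.Nodup) (p e : α × Bool → K) (s t : K)
    (h : Path p e s (w.filter (fun d => decide (d ≠ z))) t) :
    ∃ κ, Path (Function.update p z κ) (Function.update e z κ) s w t := by
  induction w generalizing s with
  | nil => exact ⟨p z, h⟩
  | cons d w ih =>
    rw [List.nodup_cons] at hnd
    by_cases hd : d = z
    · subst hd
      have hf : w.filter (fun d' => decide (d' ≠ d)) = w := by
        rw [List.filter_eq_self]
        intro d' hd'
        simp only [decide_eq_true_eq]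
        rintro rfl
        exact hnd.1 hd'
      rw [List.filter_cons_of_neg (by simp), hf] at h
      refine ⟨s, by simp, ?_⟩
      rw [Function.update_self]
      refine path_congr ?_ h
      intro d' hd'
      have : d' ≠ d := by rintro rfl; exact hnd.1 hd'
      simp [Function.update_of_ne this]
    · rw [List.filter_cons_of_pos (by simpa using hd)] at h
      obtain ⟨κ, hκ⟩ := ih hnd.2 _ h.2
      refine ⟨κ, ?_, ?_⟩
      · rw [Function.update_of_ne hd]; exact h.1
      · rw [Function.update_of_ne hd]; exact hκ

theorem reinserts {α K : Type} [DecidableEq α] (z : α × Bool) (W : List (List (α × Bool)))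
    (hnd : W.flatten.Nodup) (p e : α × Bool → K)
    (h : ∀ w ∈ W, ∃ s, Path p e s (w.filter (fun d => decide (d ≠ z))) s) :
    ∃ κ, ∀ w ∈ W, ∃ s, Path (Function.update p z κ) (Function.update e z κ) s w s := by
  rw [List.nodup_flatten] at hnd
  have key : ∀ κ, ∀ w ∈ W, z ∉ w →
      ∃ s, Path (Function.update p z κ) (Function.update e z κ) s w s := by
    intro κ w hw hz
    obtain ⟨s, hs⟩ := h w hw
    refine ⟨s, ?_⟩
    have hne : ∀ d ∈ w, d ≠ z := by
      rintro d hd rfl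
      exact hz hd
    rw [List.filter_eq_self.2 (by intro d hd; simpa using hne d hd)] at hs
    refine path_congr ?_ hs
    intro d hd
    simp [Function.update_of_ne (hne d hd)]
  by_cases hz : ∃ w ∈ W, z ∈ w
  · obtain ⟨w0, hw0, hz0⟩ := hz
    obtain ⟨s, hs⟩ := h w0 hw0
    obtain ⟨κ, hκ⟩ := reinsert z w0 (hnd.1 w0 hw0) p e s s hs
    refine ⟨κ, fun w hw => ?_⟩
    by_cases hww : w = w0
    · subst hww; exact ⟨s, hκ⟩
    · refine key κ w hw fun hzw => ?_
      have : Std.Symm (List.Disjoint (α := α × Bool)) := ⟨fun _ _ h => h.symm⟩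
      have := hnd.2.forall hw hw0 hww
      exact this hzw hz0
  · push Not at hz
    exact ⟨p z, fun w hw => key _ w hw (hz w hw)⟩

theorem col_sum {α K : Type} (W : List (List (α × Bool))) (p e : α × Bool → K) (χ : K → ℤ)
    (h : ∀ w ∈ W, ∃ s, Path p e s w s) :
    (W.flatten.map (fun d => χ (p d))).sum = (W.flatten.map (fun d => χ (e d))).sum := by
  induction W with
  | nil => rfl
  | cons w W ih =>
    obtain ⟨s, hs⟩ := h w (by simp)
    have h1 := path_sum χ hs
    have h2 := ih fun w hw => h w (by simp [hw])
    simp only [List.flatten_cons, List.map_append, List.sum_append]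
    linarith

theorem extend_col {α K C : Type} (W : List (List (α × Bool))) (o : α × Bool → C)
    (hnd : W.flatten.Nodup) (hcl : ∀ d ∈ W.flatten, inv d ∈ W.flatten) (ho : Col o W)
    (a : α × Bool) (ha : a ∈ W.flatten) (hoa : o a ≠ o (inv a)) (c : α × Bool → K)
    (P : α × Bool → Bool) (hP : ∀ d, P d = true ↔ d.1 ≠ a.1)
    (hc : Col c (W.map (fun w => w.filter P))) :
    ∃ c' : α × Bool → K, Col c' W ∧ c' a = c' (inv a) ∧ ∀ d, d.1 ≠ a.1 → c' d = c d := by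
  classical
  have hne : inv a ≠ a := inv_ne a
  have step1 : ∃ κ, ∀ w ∈ W.map (fun w => w.filter (fun d => decide (d ≠ inv a))), ∃ s,
      Path (Function.update c a κ) (Function.update (fun d => c (inv d)) a κ) s w s := by
    apply reinserts
    · rw [← List.filter_flatten]
      exact hnd.filter _
    · intro w hw
      obtain ⟨w, hw1, rfl⟩ := List.mem_map.1 hw
      obtain ⟨s, hs⟩ := hc _ (List.mem_map_of_mem hw1)
      refine ⟨s, ?_⟩
      rw [List.filter_filter]
      convert hs using 2
      funext d
      rw [Bool.eq_iff_iff, hP]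
      simp only [Bool.and_eq_true, decide_eq_true_eq]
      constructor
      · rintro ⟨h1, h2⟩ h3
        rcases fst_eq h3 with h | h
        · exact h1 h
        · exact h2 h
      · intro h
        exact ⟨fun h1 => h (by rw [h1]), fun h1 => h (by rw [h1, inv_fst])⟩
  obtain ⟨κ, hκ⟩ := step1
  obtain ⟨κ', hκ'⟩ := reinserts (inv a) W hnd (Function.update c a κ)
    (Function.update (fun d => c (inv d)) a κ)
    (fun w hw => hκ _ (List.mem_map_of_mem hw))
  set p := Function.update (Function.update c a κ) (inv a) κ' with hp
  set e := Function.update (Function.update (fun d => c (inv d)) a κ) (inv a) κ' with he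
  have pa : p a = κ := by simp [hp, Function.update_of_ne hne.symm]
  have pia : p (inv a) = κ' := by simp [hp]
  have ea : e a = κ := by simp [he, Function.update_of_ne hne.symm]
  have eia : e (inv a) = κ' := by simp [he]
  have pd : ∀ d, d.1 ≠ a.1 → p d = c d := by
    intro d hd
    have h1 : d ≠ a := fun h => hd (by rw [h])
    have h2 : d ≠ inv a := fun h => hd (by rw [h, inv_fst])
    simp [hp, Function.update_of_ne h1, Function.update_of_ne h2]
  have ed : ∀ d, d.1 ≠ a.1 → e d = c (inv d) := by
    intro d hd
    have h1 : d ≠ a := fun h => hd (by rw [h])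
    have h2 : d ≠ inv a := fun h => hd (by rw [h, inv_fst])
    simp [he, Function.update_of_ne h1, Function.update_of_ne h2]
  have hkk : κ = κ' := by
    by_contra hkk
    let χ : C × K → ℤ := fun v => if v = (o a, κ) then 1 else 0
    have hsum := col_sum W (fun d => (o d, p d)) (fun d => (o (inv d), e d)) χ (by
      intro w hw
      obtain ⟨s, hs⟩ := ho w hw
      obtain ⟨t, ht⟩ := hκ' w hw
      exact ⟨_, path_prod hs ht⟩)
    rw [← List.sum_toFinset _ hnd, ← List.sum_toFinset _ hnd] at hsum
    have hbij : ∑ d ∈ W.flatten.toFinset, χ (o (inv d), e d) =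
        ∑ d ∈ W.flatten.toFinset, χ (o d, e (inv d)) := by
      refine Finset.sum_bij' (fun d _ => inv d) (fun d _ => inv d) ?_ ?_ ?_ ?_ ?_
      · intro d hd
        rw [List.mem_toFinset] at hd ⊢
        exact hcl d hd
      · intro d hd
        rw [List.mem_toFinset] at hd ⊢
        exact hcl d hd
      · intro d _; exact inv_inv d
      · intro d _; exact inv_inv d
      · intro d _; rw [inv_inv]
    rw [hbij] at hsum
    have hlt : ∑ d ∈ W.flatten.toFinset, χ (o d, e (inv d)) <
        ∑ d ∈ W.flatten.toFinset, χ (o d, p d) := by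
      apply Finset.sum_lt_sum
      · intro d _
        by_cases hd : d.1 = a.1
        · rcases fst_eq hd with rfl | rfl
          · rw [pa, eia]
            simp only [χ, if_true]
            split_ifs <;> norm_num
          · rw [inv_inv, ea, pia]
            have h1 : (o (inv a), κ) ≠ (o a, κ) := fun h => hoa (Prod.ext_iff.1 h).1.symm
            have h2 : (o (inv a), κ') ≠ (o a, κ) := fun h => hoa (Prod.ext_iff.1 h).1.symm
            simp only [χ, if_neg h1, if_neg h2, le_refl]
        · rw [pd d hd, ed (inv d) hd, inv_inv]
      · refine ⟨a, by rw [List.mem_toFinset]; exact ha, ?_⟩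
        rw [pa, eia]
        have h1 : (o a, κ') ≠ (o a, κ) := fun h => hkk (Prod.ext_iff.1 h).2.symm
        simp only [χ, if_true, if_neg h1]
        norm_num
    exact absurd hsum hlt.ne'
  refine ⟨p, ?_, by rw [pa, pia, hkk], pd⟩
  intro w hw
  obtain ⟨s, hs⟩ := hκ' w hw
  refine ⟨s, path_congr (fun d _ => ⟨rfl, ?_⟩) hs⟩
  by_cases hd : d.1 = a.1
  · rcases fst_eq hd with rfl | rfl
    · rw [ea, pia, hkk]
    · rw [eia, inv_inv, pa, hkk]
  · rw [ed d hd, pd (inv d) hd]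


theorem mk_filter {α Q : Type} [Group Q] (f : FreeGroup α →* Q) (x : α)
    (P : α × Bool → Bool) (hP : ∀ d, P d = true ↔ d.1 ≠ x) (hx : f (FreeGroup.of x) = 1)
    (w : List (α × Bool)) : f (FreeGroup.mk (w.filter P)) = f (FreeGroup.mk w) := by
  induction w with
  | nil => rfl
  | cons d w ih =>
    by_cases hd : P d = true
    · rw [List.filter_cons_of_pos hd, mk_cons, mk_cons d w, map_mul, map_mul, ih]
    · rw [List.filter_cons_of_neg hd, mk_cons d w, map_mul, ih]
      have hdx : d.1 = x := by
        by_contra h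
        exact hd ((hP d).2 h)
      have : f (FreeGroup.mk [d]) = 1 := by
        rcases d with ⟨y, b⟩
        simp only at hdx
        subst hdx
        cases b
        · rw [mk_false, map_inv, hx, inv_one]
        · exact hx
      rw [this, one_mul]

theorem contract {α C Q : Type} [Group Q] [DecidableEq C] (n : ℕ) :
    ∀ (W : List (List (α × Bool))) (o : α × Bool → C) (V : Finset C) (h : ℕ),
    V.card = n + 1 → 1 ≤ h → W.flatten.Nodup → (∀ d ∈ W.flatten, inv d ∈ W.flatten) →
    Col o W → (∀ d ∈ W.flatten, o d ∈ V) →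
    (∀ c : α × Bool → Prop, Col c W → ∀ d ∈ W.flatten, ∀ d' ∈ W.flatten,
      o d = o d' → c d → c d') →
    (∀ f : C → Prop, (∀ d ∈ W.flatten, f (o d) → f (o (inv d))) →
      ∀ v ∈ V, ∀ v' ∈ V, f v → f v') →
    (∀ w ∈ W, w ≠ []) →
    2 * V.card + 2 * W.length + 4 * h = W.flatten.length + 4 →
    ∃ T : Set α,
      (∀ q : α → Q, ∃ s : C → Q, ∀ x ∈ T, s (o (x, true)) * q x = s (o (x, false))) ∧
      (∀ f : C → Prop, (∀ x ∈ T, f (o (x, true)) ↔ f (o (x, false))) →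
        ∀ v ∈ V, ∀ v' ∈ V, f v → f v') ∧
      Nonempty (PresentedGroup (rels W ∪ FreeGroup.of '' T) ≃* SurfaceGroup h) := by
  classical
  induction n with
  | zero =>
    intro W o V h hV hh hnd hcl ho hoV huniv hgraph hne hE
    obtain ⟨v, rfl⟩ := Finset.card_eq_one.1 hV
    refine ⟨∅, fun q => ⟨fun _ => 1, by simp⟩, ?_, ?_⟩
    · intro f _ v1 h1 v2 h2
      rw [Finset.mem_singleton] at h1 h2
      rw [h1, h2]; exact id
    · rw [Set.image_empty, Set.union_empty]
      apply merge_words _ W h rfl hh hnd hcl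
      · intro c hc d hd d' hd'
        refine huniv c hc d hd d' hd' ?_
        have h1 := hoV d hd
        have h2 := hoV d' hd'
        rw [Finset.mem_singleton] at h1 h2
        rw [h1, h2]
      · exact hne
      · rw [hV] at hE; omega
  | succ n ih =>
    intro W o V h hV hh hnd hcl ho hoV huniv hgraph hne hE
    -- an edge with distinct ends
    have hex : ∃ x, (x, true) ∈ W.flatten ∧ o (x, true) ≠ o (x, false) := by
      have : ∃ d ∈ W.flatten, o d ≠ o (inv d) := by
        by_contra hcon
        push Not at hcon
        obtain ⟨v0, h0, v1, h1, h01⟩ := Finset.one_lt_card.1 (by omega : 1 < V.card)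
        exact h01 (hgraph (fun v => v = v0) (fun d hd h => by rw [← hcon d hd]; exact h)
          v0 h0 v1 h1 rfl).symm
      obtain ⟨⟨x, b⟩, hd, hod⟩ := this
      cases b
      · exact ⟨x, hcl _ hd, fun h => hod h.symm⟩
      · exact ⟨x, hd, hod⟩
    obtain ⟨x, ha, hoa⟩ := hex
    have hia : (x, false) ∈ W.flatten := hcl _ ha
    have hinva : inv (x, true) = (x, false) := rfl
    have hinvb : inv (x, false) = (x, true) := rfl
    have hx2 : ∀ d : α × Bool, d.1 = x ↔ d = (x, true) ∨ d = (x, false) := by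
      rintro ⟨y, b⟩
      cases b <;> simp
    obtain ⟨P, hP⟩ : ∃ P : α × Bool → Bool, ∀ d, P d = true ↔ d.1 ≠ x :=
      ⟨fun d => decide (d.1 ≠ x), by simp⟩
    obtain ⟨m, m1, m2⟩ : ∃ m : C → C, m (o (x, false)) = o (x, true) ∧
        ∀ v, v ≠ o (x, false) → m v = v :=
      ⟨fun v => if v = o (x, false) then o (x, true) else v, by simp, fun v hv => by simp [hv]⟩
    have m3 : m (o (x, true)) = o (x, true) := m2 _ hoa
    set W2 := W.map (fun w => w.filter P) with hW2
    have hfl : W2.flatten = W.flatten.filter P := by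
      rw [hW2, List.filter_flatten]
    have hmem2 : ∀ d, d ∈ W2.flatten ↔ d ∈ W.flatten ∧ d.1 ≠ x := by
      intro d
      rw [hfl, List.mem_filter, hP]
    have hnd2 : W2.flatten.Nodup := by rw [hfl]; exact hnd.filter _
    have hlen : W.flatten.length = W2.flatten.length + 2 := by
      have hp : W.flatten.Perm ((x, true) :: (x, false) :: W2.flatten) := by
        rw [List.perm_ext_iff_of_nodup hnd]
        · intro d
          rw [List.mem_cons, List.mem_cons, ← or_assoc, ← hx2, hmem2]
          constructor
          · intro hd
            by_cases hdx : d.1 = x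
            · exact Or.inl hdx
            · exact Or.inr ⟨hd, hdx⟩
          · rintro (hdx | hd)
            · rcases (hx2 d).1 hdx with rfl | rfl
              · exact ha
              · exact hia
            · exact hd.1
        · simp [hnd2, hmem2]
      rw [hp.length_eq]; simp
    have hlenW : W2.length = W.length := by rw [hW2, List.length_map]
    have hVb : o (x, false) ∈ V := hoV _ hia
    have hVa : o (x, true) ∈ V := hoV _ ha
    have hcardV : (V.erase (o (x, false))).card = n + 1 := by
      rw [Finset.card_erase_of_mem hVb, hV]; rfl
    obtain ⟨T, hT1, hT2, ⟨e⟩⟩ := ih W2 (m ∘ o) (V.erase (o (x, false))) h hcardV hh hnd2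
      (by
        intro d hd
        rw [hmem2] at hd ⊢
        exact ⟨hcl d hd.1, hd.2⟩)
      (by
        intro w hw
        obtain ⟨w, hw1, rfl⟩ := List.mem_map.1 hw
        obtain ⟨s, hs⟩ := ho w hw1
        refine ⟨m s, path_filter P ?_ (path_map m hs)⟩
        intro d hd
        have hdx : d.1 = x := by
          by_contra hc
          rw [(hP d).2 hc] at hd
          exact absurd hd (by simp)
        rcases (hx2 d).1 hdx with rfl | rfl
        · simp only [Function.comp, hinva, m1, m3]
        · simp only [Function.comp, hinvb, m1, m3])
      (by
        intro d hd
        rw [hmem2] at hd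
        rw [Finset.mem_erase, Function.comp]
        by_cases hdb : o d = o (x, false)
        · rw [hdb, m1]; exact ⟨hoa, hVa⟩
        · rw [m2 _ hdb]; exact ⟨hdb, hoV d hd.1⟩)
      (by
        intro c hc d hd d' hd' hdd' hcd
        obtain ⟨c', hc1, hc2, hc3⟩ := extend_col W o hnd hcl ho (x, true) ha hoa c P hP hc
        rw [hmem2] at hd hd'
        rw [hinva] at hc2
        have key : ∀ d ∈ W.flatten, ∃ d2 ∈ W.flatten, o d2 = m (o d) ∧ (c' d ↔ c' d2) := by
          intro d hd
          by_cases hdb : o d = o (x, false)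
          · refine ⟨(x, true), ha, by rw [hdb, m1], ?_⟩
            rw [hc2]
            exact ⟨huniv c' hc1 _ hd _ hia hdb, huniv c' hc1 _ hia _ hd hdb.symm⟩
          · exact ⟨d, hd, (m2 _ hdb).symm, Iff.rfl⟩
        obtain ⟨d2, hd2, ho2, hcd2⟩ := key d hd.1
        obtain ⟨d3, hd3, ho3, hcd3⟩ := key d' hd'.1
        rw [← hc3 d' hd'.2, hcd3]
        rw [← hc3 d hd.2, hcd2] at hcd
        exact huniv c' hc1 d2 hd2 d3 hd3 (by rw [ho2, ho3]; exact hdd') hcd)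
      (by
        intro f hf v hv v' hv' hfv
        rw [Finset.mem_erase] at hv hv'
        have := hgraph (fun v => f (m v)) (by
          intro d hd
          by_cases hdx : d.1 = x
          · rcases (hx2 d).1 hdx with rfl | rfl
            · rw [hinva, m1, m3]; exact id
            · rw [hinvb, m1, m3]; exact id
          · exact hf d ((hmem2 d).2 ⟨hd, hdx⟩)) v hv.2 v' hv'.2
        rw [m2 _ hv.1, m2 _ hv'.1] at this
        exact this hfv)
      (by
        intro w hw
        obtain ⟨w, hw1, rfl⟩ := List.mem_map.1 hw
        intro hemp
        have hwx : ∀ d ∈ w, d.1 = x := by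
          intro d hd
          by_contra hc
          have := List.mem_filter.2 ⟨hd, (hP d).2 hc⟩
          rw [hemp] at this
          exact absurd this (by simp)
        have hndw := List.nodup_flatten.1 hnd
        have hboth : ∀ e, e.1 = x → e ∈ w := by
          obtain ⟨s, hs⟩ := ho w hw1
          have hwnd := hndw.1 w hw1
          have hwne := hne w hw1
          have hd12 : ∃ d, d ∈ w ∧ inv d ∈ w := by
            rcases w with _ | ⟨d, _ | ⟨d2, w'⟩⟩
            · exact absurd rfl hwne
            · have h1 : o d = s := hs.1
              have h2 : o (inv d) = s := hs.2
              rcases (hx2 d).1 (hwx d (by simp)) with rfl | rfl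
              · exact absurd (h1.trans h2.symm) hoa
              · exact absurd (h2.trans h1.symm) hoa
            · have h2 : d2.1 = d.1 := by
                rw [hwx d (by simp), hwx d2 (by simp)]
              rcases fst_eq h2 with rfl | rfl
              · simp at hwnd
              · exact ⟨d, by simp, by simp⟩
          obtain ⟨d, hd1, hd2⟩ := hd12
          intro e he
          have h2 : e.1 = d.1 := by rw [he, hwx d hd1]
          rcases fst_eq h2 with rfl | rfl
          · exact hd1
          · exact hd2
        have hcol : Col (fun d => d ∈ {d : α × Bool | d.1 = x}) W := by
          apply col_of_closed
          · intro d hd; exact hd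
          · intro w' hw'
            by_cases hww : w' = w
            · subst hww; exact Or.inl hwx
            · right
              intro d hd hdx
              have : Std.Symm (List.Disjoint (α := α × Bool)) := ⟨fun _ _ h => h.symm⟩
              exact hndw.2.forall hw' hw1 hww hd (hboth d hdx)
        have hall : ∀ e ∈ W.flatten, e.1 = x := by
          intro e he
          refine hgraph (fun v => ∀ e ∈ W.flatten, o e = v → e.1 = x) ?_ _ hVa _ (hoV e he) ?_ e he rfl
          · intro d hd hf e he hoe
            exact huniv _ hcol (inv d) (hcl d hd) e he hoe.symm (hf d hd rfl)
          · intro e he hoe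
            exact huniv _ hcol (x, true) ha e he hoe.symm rfl
        have : W2.flatten.length = 0 := by
          rw [List.length_eq_zero_iff, List.eq_nil_iff_forall_not_mem]
          intro d hd
          rw [hmem2] at hd
          exact hd.2 (hall d hd.1)
        omega)
      (by omega)
    refine ⟨insert x T, ?_, ?_, ?_⟩
    · intro q
      let k : C → Q := fun v => if v = o (x, false) then q x else 1
      obtain ⟨s, hs⟩ := hT1 (fun y => k (o (y, true)) * q y * (k (o (y, false)))⁻¹)
      refine ⟨fun v => s (m v) * k v, ?_⟩
      intro y hy
      rcases Set.mem_insert_iff.1 hy with rfl | hy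
      · simp only [k, if_neg hoa, if_true, m1, m3, mul_one]
      · have h1 := hs y hy
        simp only [Function.comp] at h1
        beta_reduce
        rw [← h1]
        group
    · intro f hf v hv v' hv' hfv
      have hfm : ∀ v, f (m v) ↔ f v := by
        intro v
        by_cases hvb : v = o (x, false)
        · rw [hvb, m1]; exact hf x (Set.mem_insert _ _)
        · rw [m2 _ hvb]
      have hmV : ∀ v ∈ V, m v ∈ V.erase (o (x, false)) := by
        intro v hv
        rw [Finset.mem_erase]
        by_cases hvb : v = o (x, false)
        · rw [hvb, m1]; exact ⟨hoa, hVa⟩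
        · rw [m2 _ hvb]; exact ⟨hvb, hv⟩
      rw [← hfm]
      refine hT2 f ?_ (m v) (hmV v hv) _ (hmV v' hv') ((hfm v).2 hfv)
      intro y hy
      simp only [Function.comp, hfm]
      exact hf y (Set.mem_insert_of_mem _ hy)
    · obtain ⟨e2⟩ := presEquiv (MulEquiv.refl (FreeGroup α))
        (rels W ∪ FreeGroup.of '' (insert x T)) (rels W2 ∪ FreeGroup.of '' T) (by
        intro Q' _ f
        have split : ∀ (W : List (List (α × Bool))) (T : Set α),
            (∀ r ∈ rels W ∪ FreeGroup.of '' T, f r = 1) ↔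
            ((∀ w ∈ W, f (FreeGroup.mk w) = 1) ∧
              ∀ x, (x, true) ∉ W.flatten → f (FreeGroup.of x) = 1) ∧
              ∀ x ∈ T, f (FreeGroup.of x) = 1 := by
          intro W T
          rw [← killsRels]
          constructor
          · intro h
            exact ⟨fun r hr => h r (Or.inl hr), fun x hx => h _ (Or.inr ⟨x, hx, rfl⟩)⟩
          · rintro ⟨h1, h2⟩ r (hr | ⟨x, hx, rfl⟩)
            · exact h1 r hr
            · exact h2 x hx
        simp only [MulEquiv.refl_apply]
        rw [split, split]
        constructor
        · rintro ⟨⟨h1, h2⟩, h3⟩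
          have hfx := h3 x (Set.mem_insert _ _)
          refine ⟨⟨?_, ?_⟩, fun y hy => h3 y (Set.mem_insert_of_mem _ hy)⟩
          · intro w hw
            obtain ⟨w, hw1, rfl⟩ := List.mem_map.1 hw
            rw [mk_filter f x P hP hfx]
            exact h1 w hw1
          · intro y hy
            by_cases hyx : y = x
            · rw [hyx, hfx]
            · exact h2 y fun hc => hy ((hmem2 _).2 ⟨hc, hyx⟩)
        · rintro ⟨⟨h1, h2⟩, h3⟩
          have hfx : f (FreeGroup.of x) = 1 := h2 x (by rw [hmem2]; simp)
          refine ⟨⟨?_, ?_⟩, ?_⟩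
          · intro w hw
            rw [← mk_filter f x P hP hfx]
            exact h1 _ (List.mem_map_of_mem hw)
          · intro y hy
            exact h2 y fun hc => hy ((hmem2 _).1 hc).1
          · intro y hy
            rcases Set.mem_insert_iff.1 hy with rfl | hy
            · exact hfx
            · exact h3 y hy)
      exact ⟨e2.trans e⟩


/-! ### Coverings -/

section cover

variable {S X C : Type} [Group S] [MulAction S C] (ρ : X → S)

/-- value of a word -/
def wv (w : List (X × Bool)) : S := FreeGroup.lift ρ (FreeGroup.mk w)

/-- the right action of a letter on the vertices -/
def act (c : C) (y : X × Bool) : C := (wv ρ [y])⁻¹ • c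

/-- the dart with origin `v` lying over `y` -/
def dart (v : C) (y : X × Bool) : (C × X) × Bool :=
  if y.2 then ((v, y.1), true) else ((act ρ v y, y.1), false)

/-- origin of a dart -/
def org (d : (C × X) × Bool) : C :=
  if d.2 then d.1.1 else (ρ d.1.2)⁻¹ • d.1.1

/-- lift of a word starting at a vertex -/
def lft : C → List (X × Bool) → List ((C × X) × Bool)
  | _, [] => []
  | c, y :: w => dart ρ c y :: lft (act ρ c y) w

theorem wv_nil : wv ρ ([] : List (X × Bool)) = 1 := by
  rw [wv, ← FreeGroup.one_eq_mk, map_one]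

theorem wv_append (u w : List (X × Bool)) : wv ρ (u ++ w) = wv ρ u * wv ρ w := by
  rw [wv, mk_append, map_mul]; rfl

theorem wv_cons (y : X × Bool) (w : List (X × Bool)) : wv ρ (y :: w) = wv ρ [y] * wv ρ w :=
  wv_append ρ [y] w

theorem wv_true (x : X) : wv ρ [(x, true)] = ρ x := by
  change FreeGroup.lift ρ (FreeGroup.of x) = ρ x
  simp

theorem wv_inv (y : X × Bool) : wv ρ [inv y] = (wv ρ [y])⁻¹ := by
  rw [wv, mk_inv, map_inv]; rfl

theorem wv_false (x : X) : wv ρ [(x, false)] = (ρ x)⁻¹ := by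
  rw [← wv_true ρ x]
  exact wv_inv ρ (x, true)

theorem act_inv (c : C) (y : X × Bool) : act ρ (act ρ c y) (inv y) = c := by
  rw [act, act, wv_inv, _root_.inv_inv, smul_inv_smul]

theorem act_true (c : C) (x : X) : act ρ c (x, true) = (ρ x)⁻¹ • c := by
  rw [act, wv_true]

theorem act_false (c : C) (x : X) : act ρ c (x, false) = ρ x • c := by
  rw [act, wv_false, _root_.inv_inv]

theorem dart_true (c : C) (x : X) : dart ρ c (x, true) = ((c, x), true) := rfl

theorem dart_false (c : C) (x : X) : dart ρ c (x, false) = ((ρ x • c, x), false) := by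
  rw [← act_false]; rfl

theorem org_dart (v : C) (y : X × Bool) : org ρ (dart ρ v y) = v := by
  rcases y with ⟨x, b⟩
  cases b
  · rw [dart_false]; simp [org]
  · rfl

theorem inv_dart (v : C) (y : X × Bool) : inv (dart ρ v y) = dart ρ (act ρ v y) (inv y) := by
  rcases y with ⟨x, b⟩
  cases b
  · rw [dart_false, act_false]; rfl
  · rw [dart_true, act_true]
    change ((v, x), false) = dart ρ ((ρ x)⁻¹ • v) (x, false)
    rw [dart_false, smul_inv_smul]

theorem dart_surj (d : (C × X) × Bool) : ∃ v y, dart ρ v y = d := by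
  rcases d with ⟨⟨c, x⟩, b⟩
  cases b
  · exact ⟨(ρ x)⁻¹ • c, (x, false), by rw [dart_false, smul_inv_smul]⟩
  · exact ⟨c, (x, true), rfl⟩

theorem lft_append (c : C) (u w : List (X × Bool)) :
    lft ρ c (u ++ w) = lft ρ c u ++ lft ρ ((wv ρ u)⁻¹ • c) w := by
  induction u generalizing c with
  | nil => simp [lft, wv_nil]
  | cons y u ih =>
    rw [List.cons_append, lft, lft, ih, wv_cons, mul_inv_rev, mul_smul]; rfl

theorem lft_length (c : C) (w : List (X × Bool)) : (lft ρ c w).length = w.length := by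
  induction w generalizing c with
  | nil => rfl
  | cons y w ih => simp [lft, ih]

theorem lft_path (c : C) (w : List (X × Bool)) :
    Path (org ρ) (fun d => org ρ (inv d)) c (lft ρ c w) ((wv ρ w)⁻¹ • c) := by
  induction w generalizing c with
  | nil => simp [lft, wv_nil, Path]
  | cons y w ih =>
    refine ⟨org_dart ρ c y, ?_⟩
    beta_reduce
    rw [inv_dart, org_dart, wv_cons, mul_inv_rev, mul_smul]
    exact ih _

theorem lft_univ {K : Type} (c : (C × X) × Bool → K) (w : List (X × Bool)) (A B : C → K)
    (h : ∀ v, Path c (fun d => c (inv d)) (A v) (lft ρ v w) (B v)) (u : C) :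
    Path (fun y => c (dart ρ u y)) (fun y => c (dart ρ u (inv y))) (A u) w (B (wv ρ w • u)) := by
  induction w generalizing A B with
  | nil =>
    rw [wv_nil, one_smul]
    exact h u
  | cons y w ih =>
    refine ⟨(h u).1, ?_⟩
    have h2 : ∀ v, Path c (fun d => c (inv d)) (c (dart ρ v (inv y))) (lft ρ v w)
        (B (wv ρ [y] • v)) := by
      intro v
      have h3 := (h (wv ρ [y] • v)).2
      beta_reduce at h3
      have h4 : act ρ (wv ρ [y] • v) y = v := by rw [act, inv_smul_smul]
      rw [inv_dart, h4] at h3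
      exact h3
    have := ih (fun v => c (dart ρ v (inv y))) (fun v => B (wv ρ [y] • v)) h2
    rw [wv_cons, mul_smul]
    exact this

theorem dart_mem (R : List (X × Bool)) (hR : ∀ y, y ∈ R) (d : (C × X) × Bool) :
    ∃ c, d ∈ lft ρ c R := by
  obtain ⟨v, y, rfl⟩ := dart_surj ρ d
  obtain ⟨p, q, hpq⟩ := List.append_of_mem (hR y)
  refine ⟨wv ρ p • v, ?_⟩
  rw [hpq, lft_append, inv_smul_smul, lft]
  simp

end cover

/-- the surface relator as a word -/
def rword (g : ℕ) : List ((Fin g × Bool) × Bool) :=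
  (List.finRange g).flatMap fun i =>
    [((i, true), true), ((i, false), true), ((i, true), false), ((i, false), false)]

theorem mk_rword (g : ℕ) : FreeGroup.mk (rword g) = surfaceRelator g := by
  rw [rword, surfaceRelator, List.ofFn_eq_map]
  generalize List.finRange g = l
  induction l with
  | nil => rfl
  | cons i l ih =>
    rw [List.flatMap_cons, mk_append, ih, List.map_cons, List.prod_cons]
    congr 1

theorem rword_length (g : ℕ) : (rword g).length = 4 * g := by
  simp [rword, List.length_flatMap, mul_comm]

theorem mem_rword (g : ℕ) (y : (Fin g × Bool) × Bool) : y ∈ rword g := by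
  rcases y with ⟨⟨i, b⟩, b'⟩
  rw [rword, List.mem_flatMap]
  refine ⟨i, List.mem_finRange i, ?_⟩
  cases b <;> cases b' <;> simp

theorem rword_const (g : ℕ) {K : Type} (c : (Fin g × Bool) × Bool → K) (s t : K)
    (h : Path c (fun d => c (inv d)) s (rword g) t) : ∀ y, c y = s := by
  have key : ∀ l : List (Fin g), ∀ s, Path c (fun d => c (inv d)) s (l.flatMap fun i =>
      [((i, true), true), ((i, false), true), ((i, true), false), ((i, false), false)]) t →
      ∀ i ∈ l, ∀ b b', c ((i, b), b') = s := by
    intro l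
    induction l with
    | nil => intro s _ i hi; simp at hi
    | cons j l ih =>
      intro s h i hi
      rw [List.flatMap_cons] at h
      obtain ⟨h1, h2, h3, h4, h5⟩ := h
      simp only [inv, Bool.not_true, Bool.not_false] at h2 h3 h4 h5
      have e1 : c ((j, false), false) = s := by rw [h4, h1]
      have e2 : c ((j, true), false) = s := by rw [h3, e1]
      have e3 : c ((j, false), true) = s := by rw [h2, e2]
      rcases List.mem_cons.1 hi with rfl | hi
      · intro b b'
        cases b <;> cases b' <;> assumption
      · rw [e3] at h5
        exact ih s h5 i hi
  rintro ⟨⟨i, b⟩, b'⟩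
  exact key _ s h i (List.mem_finRange i) b b'

theorem cover {S C Q : Type} [Group S] [Group Q] [MulAction S C] [Fintype C] [DecidableEq C]
    [MulAction.IsPretransitive S C] (g : ℕ) (hg : 2 ≤ g) (ρ : Fin g × Bool → S)
    (hgen : Subgroup.closure (Set.range ρ) = ⊤) (hρ : wv ρ (rword g) = 1) (hC : 0 < Fintype.card C) :
    ∃ T : Set (C × (Fin g × Bool)),
      (∀ q : C × (Fin g × Bool) → Q, ∃ s : C → Q, ∀ x ∈ T, s x.1 * q x = s ((ρ x.2)⁻¹ • x.1)) ∧
      (∀ f : C → Prop, (∀ x ∈ T, f x.1 ↔ f ((ρ x.2)⁻¹ • x.1)) → ∀ v v', f v → f v') ∧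
      Nonempty (PresentedGroup ({r | ∃ c, r = FreeGroup.mk (lft ρ c (rword g))} ∪ FreeGroup.of '' T) ≃*
        SurfaceGroup (Fintype.card C * (g - 1) + 1)) := by
  set W : List (List ((C × (Fin g × Bool)) × Bool)) :=
    (Finset.univ : Finset C).toList.map (fun c => lft ρ c (rword g)) with hW
  have hWm : ∀ w, w ∈ W ↔ ∃ c, lft ρ c (rword g) = w := by
    intro w; simp [hW]
  have hall : ∀ d, d ∈ W.flatten := by
    intro d
    obtain ⟨c, hc⟩ := dart_mem ρ (rword g) (mem_rword g) d
    exact List.mem_flatten.2 ⟨_, (hWm _).2 ⟨c, rfl⟩, hc⟩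
  have hlen : W.flatten.length = Fintype.card C * (4 * g) := by
    rw [List.length_flatten, hW, List.map_map]
    have : (List.length ∘ fun c : C => lft ρ c (rword g)) = fun _ => 4 * g := by
      funext c
      simp [lft_length, rword_length]
    rw [this]
    simp
  have hWlen : W.length = Fintype.card C := by simp [hW]
  have hnd : W.flatten.Nodup := by
    rw [← Multiset.coe_nodup, ← Multiset.toFinset_card_eq_card_iff_nodup]
    have : (W.flatten : Multiset ((C × (Fin g × Bool)) × Bool)).toFinset = Finset.univ := by
      ext d
      simp only [Multiset.mem_toFinset, Multiset.mem_coe, Finset.mem_univ, iff_true]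
      exact hall d
    rw [this, Multiset.coe_card, hlen, Finset.card_univ]
    simp only [Fintype.card_prod, Fintype.card_fin, Fintype.card_bool]
    ring
  have hcol : ∀ {K : Type} (c : (C × (Fin g × Bool)) × Bool → K), Col c W →
      ∀ d d', org ρ d = org ρ d' → c d = c d' := by
    intro K c hc d d' hdd
    have hc2 : ∀ v, ∃ s, Path c (fun d => c (inv d)) s (lft ρ v (rword g)) s :=
      fun v => hc _ ((hWm _).2 ⟨v, rfl⟩)
    choose A hA using hc2
    obtain ⟨u, y, rfl⟩ := dart_surj ρ d
    obtain ⟨u', y', rfl⟩ := dart_surj ρ d'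
    rw [org_dart, org_dart] at hdd
    subst hdd
    have h1 := rword_const g (fun y => c (dart ρ u y)) _ _ (lft_univ ρ c (rword g) A A hA u)
    exact (h1 y).trans (h1 y').symm
  obtain ⟨k, hk⟩ : ∃ k, Fintype.card C = k + 1 := ⟨Fintype.card C - 1, by omega⟩
  obtain ⟨T, h1, h2, ⟨e⟩⟩ := contract (Q := Q) k W (org ρ) Finset.univ
    (Fintype.card C * (g - 1) + 1) (by rw [Finset.card_univ, hk]) (by omega) hnd
    (fun d _ => hall _)
    (by
      intro w hw
      obtain ⟨c, rfl⟩ := (hWm w).1 hw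
      refine ⟨c, ?_⟩
      have := lft_path ρ c (rword g)
      rwa [hρ, inv_one, one_smul] at this)
    (fun d _ => Finset.mem_univ _)
    (by
      intro c hc d _ d' _ hdd hcd
      rw [← hcol c hc d d' hdd]; exact hcd)
    (by
      intro f hf v _ v' _ hfv
      obtain ⟨s, rfl⟩ := MulAction.exists_smul_eq S v v'
      have hstep : ∀ v y, f v → f (act ρ v y) := by
        intro v y hv
        have := hf (dart ρ v y) (hall _)
        rw [inv_dart, org_dart, org_dart] at this
        exact this hv
      have hs : s ∈ Subgroup.closure (Set.range ρ) := by rw [hgen]; trivial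
      revert v
      induction hs using Subgroup.closure_induction'' with
      | mem x hx =>
        obtain ⟨x, rfl⟩ := hx
        intro v _ hv _
        rw [← act_false]; exact hstep _ _ hv
      | inv_mem x hx =>
        obtain ⟨x, rfl⟩ := hx
        intro v _ hv _
        rw [← act_true]; exact hstep _ _ hv
      | one =>
        intro v _ hv _
        rw [one_smul]; exact hv
      | mul x y _ _ hx hy =>
        intro v _ hv _
        rw [mul_smul]
        exact hx _ (Finset.mem_univ _) (hy v (Finset.mem_univ _) hv (Finset.mem_univ _)) (Finset.mem_univ _))
    (by
      intro w hw
      obtain ⟨c, rfl⟩ := (hWm w).1 hw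
      intro h
      have := congrArg List.length h
      rw [lft_length, rword_length] at this
      simp at this
      omega)
    (by
      rw [hlen, hWlen, Finset.card_univ]
      obtain ⟨g', rfl⟩ : ∃ g', g = g' + 1 := ⟨g - 1, by omega⟩
      simp only [Nat.add_sub_cancel]
      ring)
  refine ⟨T, ?_, ?_, ?_⟩
  · intro q
    obtain ⟨s, hs⟩ := h1 q
    exact ⟨s, fun x hx => hs x hx⟩
  · intro f hf v v' hv
    exact h2 f hf v (Finset.mem_univ _) v' (Finset.mem_univ _) hv
  · have : rels W = {r | ∃ c, r = FreeGroup.mk (lft ρ c (rword g))} := by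
      ext r
      constructor
      · rintro (⟨w, hw, rfl⟩ | ⟨x, hx, _⟩)
        · obtain ⟨c, rfl⟩ := (hWm w).1 hw
          exact ⟨c, rfl⟩
        · exact absurd (hall _) hx
      · rintro ⟨c, rfl⟩
        exact Or.inl ⟨_, (hWm _).2 ⟨c, rfl⟩, rfl⟩
    rw [← this]
    exact ⟨e⟩


/-! ### Reidemeister–Schreier -/

theorem exists_word {X : Type} (r : Set (FreeGroup X)) (s : PresentedGroup r) :
    ∃ w, s = wv (PresentedGroup.of (rels := r)) w := by
  classical
  obtain ⟨u, rfl⟩ := PresentedGroup.mk_surjective r s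
  refine ⟨u.toWord, ?_⟩
  rw [wv, FreeGroup.mk_toWord]
  have : FreeGroup.lift (PresentedGroup.of (rels := r)) = PresentedGroup.mk r := by
    ext x; simp [PresentedGroup.of]
  rw [this]

theorem lift_word {X C Γ S : Type} [Group S] [MulAction S C] [Group Γ] (ρ : X → S)
    (γ : C × X → Γ) (Φ0 : X → Equiv.Perm (C × Γ))
    (h : ∀ x c t, (Φ0 x)⁻¹ (c, t) = ((ρ x)⁻¹ • c, t * γ (c, x)))
    (w : List (X × Bool)) (c : C) (t : Γ) :
    (wv Φ0 w)⁻¹ (c, t) = ((wv ρ w)⁻¹ • c, t * wv γ (lft ρ c w)) := by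
  induction w generalizing c t with
  | nil => simp [wv_nil, lft]
  | cons y w ih =>
    have hy : (wv Φ0 [y])⁻¹ (c, t) = (act ρ c y, t * wv γ [dart ρ c y]) := by
      rcases y with ⟨x, b⟩
      cases b
      · rw [wv_false, act_false, dart_false, wv_false, Equiv.Perm.inv_eq_iff_eq, h]
        simp
      · rw [wv_true, act_true, dart_true, wv_true, h]
    rw [wv_cons, mul_inv_rev, Equiv.Perm.mul_apply, hy, ih, lft, wv_cons γ (dart ρ c y) (lft ρ (act ρ c y) w),
      wv_cons ρ y w, mul_inv_rev,
      mul_smul, mul_assoc]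
    rfl

theorem comp_exists {X C Γ : Type} (r : FreeGroup X) (R : List (X × Bool))
    (hr : FreeGroup.mk R = r) [MulAction (PresentedGroup {r}) C] [Group Γ]
    (γ : C × X → Γ)
    (hγ : ∀ c : C, wv γ (lft (PresentedGroup.of (rels := {r})) c R) = 1) :
    ∃ comp : C → PresentedGroup {r} → Γ,
      (∀ c w, comp c (wv PresentedGroup.of w) = wv γ (lft (PresentedGroup.of (rels := {r})) c w)) := by
  let ρ : X → PresentedGroup {r} := PresentedGroup.of
  let Φ0 : X → Equiv.Perm (C × Γ) := fun x => Equiv.symm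
    { toFun := fun p => ((ρ x)⁻¹ • p.1, p.2 * γ (p.1, x))
      invFun := fun p => (ρ x • p.1, p.2 * (γ (ρ x • p.1, x))⁻¹)
      left_inv := fun p => by simp
      right_inv := fun p => by simp }
  have h0 : ∀ x c t, (Φ0 x)⁻¹ (c, t) = ((ρ x)⁻¹ • c, t * γ (c, x)) := fun x c t => rfl
  have h1 := lift_word ρ γ Φ0 h0
  have hR : wv ρ R = 1 := by
    have : FreeGroup.lift ρ = PresentedGroup.mk {r} := by
      ext x; simp [ρ, PresentedGroup.of]
    rw [wv, this, hr]
    exact PresentedGroup.one_of_mem rfl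
  have h2 : ∀ u ∈ ({r} : Set (FreeGroup X)), FreeGroup.lift Φ0 u = 1 := by
    intro u hu
    rw [Set.mem_singleton_iff.1 hu, ← hr]
    change wv Φ0 R = 1
    rw [← inv_eq_one]
    ext ⟨c, t⟩ : 1
    rw [h1, hR]
    have := hγ c
    change wv γ (lft ρ c R) = 1 at this
    rw [this]
    simp
  refine ⟨fun c s => ((PresentedGroup.toGroup h2 s)⁻¹ (c, 1)).2, ?_⟩
  intro c w
  have h3 : PresentedGroup.toGroup h2 (wv PresentedGroup.of w) = wv Φ0 w := by
    rw [wv, wv, ← MonoidHom.comp_apply]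
    congr 1
    ext x : 1
    simp
  beta_reduce
  rw [h3, h1, one_mul]

theorem schreier {X : Type} (r : FreeGroup X) (R : List (X × Bool)) (hr : FreeGroup.mk R = r)
    (H : Subgroup (PresentedGroup {r})) (T : Set ((PresentedGroup {r} ⧸ H) × X))
    (hT1 : ∀ q : (PresentedGroup {r} ⧸ H) × X → PresentedGroup {r},
      ∃ s : PresentedGroup {r} ⧸ H → PresentedGroup {r},
        ∀ x ∈ T, s x.1 * q x = s ((PresentedGroup.of x.2 : PresentedGroup {r})⁻¹ • x.1))
    (hT2 : ∀ f : PresentedGroup {r} ⧸ H → Prop,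
      (∀ x ∈ T, f x.1 ↔ f ((PresentedGroup.of x.2 : PresentedGroup {r})⁻¹ • x.1)) →
        ∀ v v', f v → f v') :
    Nonempty (H ≃* PresentedGroup ({u | ∃ c : PresentedGroup {r} ⧸ H,
      u = FreeGroup.mk (lft (PresentedGroup.of (rels := {r})) c R)} ∪ FreeGroup.of '' T)) := by
  set rel := ({u | ∃ c : PresentedGroup {r} ⧸ H,
      u = FreeGroup.mk (lft (PresentedGroup.of (rels := {r})) c R)} ∪ FreeGroup.of '' T) with hrel
  let ρ : X → PresentedGroup {r} := PresentedGroup.of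
  let γ : (PresentedGroup {r} ⧸ H) × X → PresentedGroup rel := PresentedGroup.of
  have hlg : FreeGroup.lift γ = PresentedGroup.mk rel := by
    ext x; simp [γ, PresentedGroup.of]
  have hlr : FreeGroup.lift ρ = PresentedGroup.mk {r} := by
    ext x; simp [ρ, PresentedGroup.of]
  have hR : wv ρ R = 1 := by
    rw [wv, hlr, hr]
    exact PresentedGroup.one_of_mem rfl
  obtain ⟨comp, hcomp⟩ := comp_exists r R hr γ (by
    intro c
    rw [wv, hlg]
    exact PresentedGroup.one_of_mem (Or.inl ⟨c, rfl⟩))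
  change ∀ c w, comp c (wv ρ w) = wv γ (lft ρ c w) at hcomp
  have hγT : ∀ x ∈ T, γ x = 1 := fun x hx => PresentedGroup.one_of_mem (Or.inr ⟨x, hx, rfl⟩)
  have cocyc : ∀ c s t, comp c (s * t) = comp c s * comp (s⁻¹ • c) t := by
    intro c s t
    obtain ⟨w, hw⟩ := exists_word _ s
    obtain ⟨w', hw'⟩ := exists_word _ t
    change s = wv ρ w at hw
    change t = wv ρ w' at hw'
    subst hw; subst hw'
    rw [← wv_append, hcomp, hcomp, hcomp, lft_append, wv_append]
  have comp1 : ∀ c, comp c 1 = 1 := by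
    intro c
    have := cocyc c 1 1
    simpa using this
  have compx : ∀ c x, comp c (ρ x) = γ (c, x) := by
    intro c x
    rw [← wv_true ρ x, hcomp]
    exact wv_true γ (c, x)
  obtain ⟨s, hs1, hs⟩ : ∃ s : PresentedGroup {r} ⧸ H → PresentedGroup {r},
      s ((1 : PresentedGroup {r}) : PresentedGroup {r} ⧸ H) = 1 ∧ ∀ x ∈ T, s x.1 * ρ x.2 = s ((ρ x.2)⁻¹ • x.1) := by
    obtain ⟨s, hs⟩ := hT1 (fun x => ρ x.2)
    refine ⟨fun v => (s ((1 : PresentedGroup {r}) : PresentedGroup {r} ⧸ H))⁻¹ * s v, by simp, ?_⟩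
    intro x hx
    beta_reduce
    rw [mul_assoc, hs x hx]
  set base : PresentedGroup {r} ⧸ H := ((1 : PresentedGroup {r}) : PresentedGroup {r} ⧸ H) with hbase
  have hstab : ∀ h : PresentedGroup {r}, h ∈ H ↔ h⁻¹ • base = base := by
    intro h
    rw [inv_smul_eq_iff, hbase, MulAction.Quotient.smul_coe, eq_comm, QuotientGroup.eq]
    simp
  -- the retraction
  have hpsi : ∀ w c, wv (fun x : (PresentedGroup {r} ⧸ H) × X => s x.1 * ρ x.2 * (s ((ρ x.2)⁻¹ • x.1))⁻¹)
      (lft ρ c w) = s c * wv ρ w * (s ((wv ρ w)⁻¹ • c))⁻¹ := by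
    intro w
    induction w with
    | nil => intro c; simp [lft, wv_nil]
    | cons y w ih =>
      intro c
      rw [lft, wv_cons, ih, wv_cons ρ, mul_inv_rev, mul_smul]
      have hy : wv (fun x : (PresentedGroup {r} ⧸ H) × X => s x.1 * ρ x.2 * (s ((ρ x.2)⁻¹ • x.1))⁻¹)
          [dart ρ c y] = s c * wv ρ [y] * (s (act ρ c y))⁻¹ := by
        rcases y with ⟨x, b⟩
        cases b
        · rw [dart_false, wv_false, act_false, wv_false]
          simp [mul_assoc]
        · rw [dart_true, wv_true, act_true, wv_true]
      rw [hy]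
      change _ * (s (act ρ c y) * wv ρ w * (s ((wv ρ w)⁻¹ • act ρ c y))⁻¹) =
        s c * (wv ρ [y] * wv ρ w) * (s ((wv ρ w)⁻¹ • act ρ c y))⁻¹
      group
  have hpsirel : ∀ u ∈ rel, FreeGroup.lift
      (fun x : (PresentedGroup {r} ⧸ H) × X => s x.1 * ρ x.2 * (s ((ρ x.2)⁻¹ • x.1))⁻¹) u = 1 := by
    rintro u (⟨c, rfl⟩ | ⟨x, hx, rfl⟩)
    · have := hpsi R c
      rw [hR] at this
      change wv _ (lft ρ c R) = 1
      rw [this]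
      simp
    · rw [FreeGroup.lift_apply_of, hs x hx]
      simp
  let ψ := PresentedGroup.toGroup hpsirel
  have hψ : ∀ w c, ψ (wv γ (lft ρ c w)) = s c * wv ρ w * (s ((wv ρ w)⁻¹ • c))⁻¹ := by
    intro w c
    rw [← hpsi, wv, wv, ← MonoidHom.comp_apply]
    congr 1
    ext x : 1
    simp [ψ, γ]
  let F : H →* PresentedGroup rel := MonoidHom.mk' (fun h => comp base h) (by
    rintro ⟨h, hh⟩ ⟨h', hh'⟩
    change comp base (h * h') = comp base h * comp base h'
    rw [cocyc, (hstab h).1 hh])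
  have hF : ∀ h : H, F h = comp base h := fun h => rfl
  have hinj : Function.Injective F := by
    have : ∀ h : H, ψ (F h) = h := by
      rintro ⟨h, hh⟩
      rw [hF]
      obtain ⟨w, hw⟩ := exists_word _ h
      change h = wv ρ w at hw
      have h2 := (hstab h).1 hh
      simp only
      rw [hw] at h2 ⊢
      rw [hcomp, hψ, h2, hs1]
      simp
    intro h h' hhh
    apply Subtype.ext
    rw [← this h, hhh, this h']
  have hspan : ∀ c, comp base (s c) = 1 ∧ (s c)⁻¹ • base = c := by
    intro c
    refine hT2 (fun c => comp base (s c) = 1 ∧ (s c)⁻¹ • base = c) ?_ base c ?_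
    · intro x hx
      have h1 := hs x hx
      have h2 := hγT x hx
      change _ ↔ comp base (s ((ρ x.2)⁻¹ • x.1)) = 1 ∧
        (s ((ρ x.2)⁻¹ • x.1))⁻¹ • base = (ρ x.2)⁻¹ • x.1
      rw [← h1, cocyc, mul_inv_rev, mul_smul, smul_left_cancel_iff]
      constructor
      · rintro ⟨h3, h4⟩
        rw [h3, h4, compx, h2]
        simp
      · rintro ⟨h3, h4⟩
        rw [h4, compx, h2, mul_one] at h3
        exact ⟨h3, h4⟩
    · rw [hs1, comp1]; simp
  have hsurj : Function.Surjective F := by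
    rw [← MonoidHom.range_eq_top, eq_top_iff, ← PresentedGroup.closure_range_of, Subgroup.closure_le]
    rintro _ ⟨⟨c, x⟩, rfl⟩
    have hh : s c * ρ x * (s ((ρ x)⁻¹ • c))⁻¹ ∈ H := by
      rw [hstab, mul_inv_rev, mul_inv_rev, mul_smul, mul_smul, (hspan c).2, _root_.inv_inv]
      exact (inv_smul_eq_iff.1 (hspan ((ρ x)⁻¹ • c)).2).symm
    refine ⟨⟨_, hh⟩, ?_⟩
    rw [hF]
    have h3 : comp ((ρ x)⁻¹ • c) (s ((ρ x)⁻¹ • c))⁻¹ = 1 := by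
      have := cocyc base (s ((ρ x)⁻¹ • c)) (s ((ρ x)⁻¹ • c))⁻¹
      rw [mul_inv_cancel, comp1, (hspan _).1, (hspan _).2, one_mul] at this
      exact this.symm
    simp only
    rw [cocyc, cocyc, (hspan c).1, (hspan c).2, mul_inv_rev, mul_smul, (hspan c).2, h3, compx]
    simp [γ]
  exact ⟨MulEquiv.ofBijective F ⟨hinj, hsurj⟩⟩

theorem surface_subgroup (g : ℕ) (hg : 2 ≤ g) (H : Subgroup (SurfaceGroup g)) (hH : H.index ≠ 0) :
    Nonempty (H ≃* SurfaceGroup (H.index * (g - 1) + 1)) := by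
  classical
  have : H.FiniteIndex := ⟨hH⟩
  have : Fintype (SurfaceGroup g ⧸ H) := Fintype.ofFinite _
  have hcard : Fintype.card (SurfaceGroup g ⧸ H) = H.index := by
    rw [← Nat.card_eq_fintype_card]; rfl
  obtain ⟨T, h1, h2, ⟨e⟩⟩ := cover (C := SurfaceGroup g ⧸ H) (Q := SurfaceGroup g) g hg
    (PresentedGroup.of (rels := {surfaceRelator g})) (PresentedGroup.closure_range_of _)
    (by
      have : FreeGroup.lift (PresentedGroup.of (rels := {surfaceRelator g})) =
          PresentedGroup.mk {surfaceRelator g} := by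
        ext x; simp [PresentedGroup.of]
      rw [wv, this, mk_rword]
      exact PresentedGroup.one_of_mem rfl)
    (by rw [hcard]; omega)
  rw [hcard] at e
  obtain ⟨e2⟩ := schreier (surfaceRelator g) (rword g) (mk_rword g) H T h1 h2
  exact ⟨e2.trans e⟩

end PS

/-- If `G` is a polysurface group of length `n` with filtration `Gs` whose
successive quotients are surface groups of genus `gs i ≥ 2`, and `D ≤ G` has finite
index `d`, then `D` is a polysurface group of length `n` with filtration
`D_i := D ∩ G_i` (viewed as subgroups `(Gs i).subgroupOf D` of `D`), whose successive
quotients are surface groups of genus at most `d·(gs i − 1) + 1`. -/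
theorem polysurface_subgroup_filtration
    {G : Type*} [Group G] {n d : ℕ}
    (Gs : Fin (n + 1) → Subgroup G)
    (h0 : Gs 0 = ⊥) (htop : Gs (Fin.last n) = ⊤) (hmono : Monotone Gs)
    (hnormal : ∀ i, (Gs i).Normal)
    (gs : Fin n → ℕ) (hgs : ∀ i, 2 ≤ gs i)
    (hquot : ∀ i : Fin n, ∃ f : (Gs i.succ) →* SurfaceGroup (gs i),
        Function.Surjective f ∧ f.ker = (Gs i.castSucc).subgroupOf (Gs i.succ))
    (D : Subgroup G) (hd : D.index = d) (hd0 : d ≠ 0) :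
    ((Gs 0).subgroupOf D = ⊥) ∧ ((Gs (Fin.last n)).subgroupOf D = ⊤) ∧
    (∀ i, ((Gs i).subgroupOf D).Normal) ∧
    ∃ hs : Fin n → ℕ, ∀ i : Fin n,
      2 ≤ hs i ∧ hs i ≤ d * (gs i - 1) + 1 ∧
      ∃ f : ((Gs i.succ).subgroupOf D) →* SurfaceGroup (hs i),
        Function.Surjective f ∧
        f.ker = ((Gs i.castSucc).subgroupOf D).subgroupOf ((Gs i.succ).subgroupOf D) := by
  refine ⟨by rw [h0, Subgroup.bot_subgroupOf], by rw [htop, Subgroup.top_subgroupOf],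
    fun i => (hnormal i).subgroupOf D, ?_⟩
  have key : ∀ i : Fin n, ∃ k : ℕ, 2 ≤ k ∧ k ≤ d * (gs i - 1) + 1 ∧
      ∃ f : ((Gs i.succ).subgroupOf D) →* SurfaceGroup k,
        Function.Surjective f ∧
        f.ker = ((Gs i.castSucc).subgroupOf D).subgroupOf ((Gs i.succ).subgroupOf D) := by
    intro i
    obtain ⟨f, hf, hker⟩ := hquot i
    have hg := hgs i
    -- the inclusion of `D ∩ G_{i+1}` into `G_{i+1}`
    let ι : ((Gs i.succ).subgroupOf D) →* (Gs i.succ) :=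
      { toFun := fun x => ⟨((x : D) : G), x.2⟩
        map_one' := rfl
        map_mul' := fun _ _ => rfl }
    have hιr : ι.range = D.subgroupOf (Gs i.succ) := by
      ext y
      constructor
      · rintro ⟨x, rfl⟩
        exact x.1.2
      · intro hy
        exact ⟨⟨⟨y.1, hy⟩, y.2⟩, rfl⟩
    let F := f.comp ι
    have hFr : F.range = (D.subgroupOf (Gs i.succ)).map f := by
      rw [MonoidHom.range_comp, hιr]
    have hrel0 : D.relIndex (Gs i.succ) ≠ 0 := by
      intro h
      have : D.FiniteIndex := ⟨by rw [hd]; exact hd0⟩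
      have := Subgroup.isFiniteRelIndex_of_finiteIndex (H := D) (K := Gs i.succ)
      exact Subgroup.relIndex_ne_zero h
    have hrel : D.relIndex (Gs i.succ) ≤ d := by
      rw [← hd, ← D.relIndex_top_right]
      exact Subgroup.relIndex_le_of_le_right le_top (by rw [D.relIndex_top_right, hd]; exact hd0)
    have hdvd : F.range.index ∣ D.relIndex (Gs i.succ) := by
      rw [hFr]
      exact Subgroup.index_map_dvd _ hf
    have hidx0 : F.range.index ≠ 0 := fun h => by
      rw [h, zero_dvd_iff] at hdvd; exact hrel0 hdvd
    have hidx : F.range.index ≤ d := (Nat.le_of_dvd (Nat.pos_of_ne_zero hrel0) hdvd).trans hrel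
    obtain ⟨e⟩ := PS.surface_subgroup (gs i) hg F.range hidx0
    refine ⟨F.range.index * (gs i - 1) + 1, ?_, ?_, e.toMonoidHom.comp F.rangeRestrict, ?_, ?_⟩
    · have : 1 ≤ F.range.index * (gs i - 1) :=
        Nat.mul_pos (Nat.pos_of_ne_zero hidx0) (by omega)
      omega
    · have := Nat.mul_le_mul_right (gs i - 1) hidx
      omega
    · exact e.surjective.comp F.rangeRestrict_surjective
    · ext x
      have h1 : f (ι x) = 1 ↔ ((x : D) : G) ∈ Gs i.castSucc := by
        rw [← MonoidHom.mem_ker, hker, Subgroup.mem_subgroupOf]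
        rfl
      rw [Subgroup.mem_subgroupOf, Subgroup.mem_subgroupOf, ← h1, MonoidHom.mem_ker,
        MonoidHom.comp_apply]
      change e (F.rangeRestrict x) = 1 ↔ F x = 1
      rw [map_eq_one_iff e e.injective, ← MonoidHom.mem_ker, MonoidHom.ker_rangeRestrict,
        MonoidHom.mem_ker]
  choose hs hhs using key
  exact ⟨hs, hhs⟩
end

section
/- There exists a function F : ℕ × ℕ × ℕ → ℕ with the following property: for every n ≥ 1, every finite abelian group A, every polysurface group G of length n admitting a filtration 1 = G₀ ≤ G₁ ≤ ⋯ ≤ G_n = G in which every surface quotient G_i/G_{i−1} has genus at most γ, and every central extension φ : Γ → G of G by A, there exists a subgroup W of G with [G : W] ≤ F(n, |A|, γ) and a group homomorphism s : W → Γ with φ ∘ s equal to the inclusion of W into G. -/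
open scoped commutatorElement

section Aux

/-- Left translation action of `F` on `F × F`. -/
def leftPerm (F : Type*) [Group F] : F →* Equiv.Perm (F × F) where
  toFun c := (Equiv.mulLeft c).prodCongr (Equiv.refl F)
  map_one' := by ext x <;> simp
  map_mul' a b := by ext x <;> simp [mul_assoc]

/-- Automorphisms of `F` acting on the first factor of `F × F`. -/
def autPerm (F : Type*) [Group F] : MulAut F →* Equiv.Perm (F × F) where
  toFun c := (MulEquiv.toEquiv c).prodCongr (Equiv.refl F)
  map_one' := by ext x <;> simp
  map_mul' a b := by ext x <;> simp

theorem leftPerm_apply {F : Type*} [Group F] (c : F) (x : F × F) :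
    leftPerm F c x = (c * x.1, x.2) := rfl

theorem autPerm_apply {F : Type*} [Group F] (c : MulAut F) (x : F × F) :
    autPerm F c x = (c x.1, x.2) := rfl

/-- First twisted permutation: `(f, y) ↦ (α f * y, y)`. -/
def xiPerm {F : Type*} [Group F] (α : MulAut F) : Equiv.Perm (F × F) where
  toFun x := (α x.1 * x.2, x.2)
  invFun x := (α.symm (x.1 * x.2⁻¹), x.2)
  left_inv x := by simp
  right_inv x := by simp

/-- The permutation `u ↦ [α, β] (β u) * c` of `F`. -/
def kappaPerm {F : Type*} [Group F] (α β : MulAut F) (c : F) : Equiv.Perm F :=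
  (MulEquiv.toEquiv (⁅α, β⁆ * β)).trans (Equiv.mulRight c)

/-- Second twisted permutation: `(f, y) ↦ (β f, κ y)`. -/
def etaPerm {F : Type*} [Group F] (α β : MulAut F) (c : F) : Equiv.Perm (F × F) :=
  (MulEquiv.toEquiv β).prodCongr (kappaPerm α β c)

theorem etaPerm_apply {F : Type*} [Group F] (α β : MulAut F) (c : F) (x : F × F) :
    etaPerm α β c x = (β x.1, ⁅α, β⁆ (β x.2) * c) := rfl

theorem xiPerm_apply {F : Type*} [Group F] (α : MulAut F) (x : F × F) :
    xiPerm α x = (α x.1 * x.2, x.2) := rfl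

/-- The key commutator identity. -/
theorem commutator_xi_eta {F : Type*} [Group F] (α β ρ : MulAut F) (c : F)
    (h : ⁅α, β⁆ * ρ = MulAut.conj c) :
    ⁅xiPerm α, etaPerm α β c⁆ * autPerm F ρ = leftPerm F c := by
  have key : xiPerm α * etaPerm α β c =
      leftPerm F c * (autPerm F ρ)⁻¹ * etaPerm α β c * xiPerm α := by
    have h' : ∀ f, c * ρ⁻¹ f = ⁅α, β⁆ f * c := by
      intro f
      have := congrArg (fun z : MulAut F => z (ρ⁻¹ f)) h
      simp only [MulAut.mul_apply, MulAut.apply_inv_self, MulAut.conj_apply] at this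
      rw [this]; group
    rw [← map_inv]
    ext x
    · simp only [Equiv.Perm.mul_apply, xiPerm_apply, etaPerm_apply, leftPerm_apply,
        autPerm_apply]
      rw [h', map_mul, map_mul]
      simp [commutatorElement_def, mul_assoc]
    · simp only [Equiv.Perm.mul_apply, xiPerm_apply, etaPerm_apply, leftPerm_apply,
        autPerm_apply]
  rw [commutatorElement_def, key]
  group

theorem exists_perm_rep {Γ : Type*} [Group Γ] (F : Subgroup Γ) [F.Normal] (k : ℕ)
    (p : FreeGroup (Fin (k + 1) × Bool) →* Γ) (hr : p (surfaceRelator (k + 1)) ∈ F) :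
    ∃ q : FreeGroup (Fin (k + 1) × Bool) →* Equiv.Perm (F × F),
      (∀ w f, q w * leftPerm F f * (q w)⁻¹ = leftPerm F (MulAut.conjNormal (p w) f)) ∧
      q (surfaceRelator (k + 1)) = leftPerm F ⟨_, hr⟩ := by
  classical
  set A : FreeGroup (Fin (k + 1) × Bool) →* MulAut F := MulAut.conjNormal.comp p with hA
  set c : F := ⟨_, hr⟩ with hc
  let α := A (FreeGroup.of (0, true))
  let β := A (FreeGroup.of (0, false))
  let q : FreeGroup (Fin (k + 1) × Bool) →* Equiv.Perm (F × F) :=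
    FreeGroup.lift fun t =>
      if t = (0, true) then xiPerm α
      else if t = (0, false) then etaPerm α β c
      else autPerm F (A (FreeGroup.of t))
  have q1 : q (FreeGroup.of (0, true)) = xiPerm α := by simp [q]
  have q2 : q (FreeGroup.of (0, false)) = etaPerm α β c := by simp [q]
  have q3 : ∀ (i : Fin k) b, q (FreeGroup.of (i.succ, b)) =
      autPerm F (A (FreeGroup.of (i.succ, b))) := by
    intro i b
    simp [q]
  refine ⟨q, ?_, ?_⟩
  · suffices H : ∀ w f, q w * leftPerm F f * (q w)⁻¹ = leftPerm F (A w f) from H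
    intro w
    induction w using FreeGroup.induction_on with
    | C1 => intro f; simp
    | of t =>
      intro f
      rw [mul_inv_eq_iff_eq_mul]
      obtain ⟨i, b⟩ := t
      refine Fin.cases ?_ (fun j => ?_) i
      · cases b
        · rw [q2]; ext x <;> simp [etaPerm_apply, leftPerm_apply, β]
        · rw [q1]; ext x <;> simp [xiPerm_apply, leftPerm_apply, α, mul_assoc]
      · rw [q3]; ext x <;> simp [autPerm_apply, leftPerm_apply]
    | inv_of t ih =>
      intro f
      have := ih (A (FreeGroup.of t)⁻¹ f)
      rw [← MulAut.mul_apply, ← map_mul, mul_inv_cancel, map_one, MulAut.one_apply] at this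
      rw [← this, map_inv]; group
    | mul x y hx hy =>
      intro f
      rw [map_mul, map_mul, MulAut.mul_apply, ← hx, ← hy]; group
  · let rest : FreeGroup (Fin (k + 1) × Bool) := (List.ofFn fun i : Fin k =>
      ⁅FreeGroup.of (i.succ, true), FreeGroup.of (i.succ, false)⁆).prod
    have hs : surfaceRelator (k + 1) =
        ⁅FreeGroup.of ((0 : Fin (k + 1)), true), FreeGroup.of ((0 : Fin (k + 1)), false)⁆ * rest := by
      simp [surfaceRelator, rest, List.ofFn_succ]
    have hrest : q rest = autPerm F (A rest) := by
      simp only [rest, map_list_prod, List.map_ofFn]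
      congr 2
      funext i
      simp [map_commutatorElement, q3]
    rw [hs, map_mul, map_commutatorElement, q1, q2, hrest]
    apply commutator_xi_eta
    rw [← map_commutatorElement, ← map_mul, ← hs]
    ext f
    simp [hA, hc, MulAut.conjNormal_apply]

/-- Surface data for a pair `A ≤ D` of subgroups: a map from the free group to `D`
inducing an isomorphism of `D / A` with the surface group of genus `g`. -/
def SurfData {Γ : Type*} [Group Γ] (A D : Subgroup Γ) (g : ℕ) : Prop :=
  ∃ p : FreeGroup (Fin g × Bool) →* Γ, (∀ w, p w ∈ D) ∧
    (∀ d ∈ D, ∃ a ∈ A, ∃ w, d = a * p w) ∧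
    ∀ w, p w ∈ A ↔ w ∈ Subgroup.normalClosure {surfaceRelator g}

theorem exists_hom {Γ : Type*} [Group Γ] (F D : Subgroup Γ) [F.Normal] (hFD : F ≤ D) (k : ℕ)
    (p : FreeGroup (Fin (k + 1) × Bool) →* Γ)
    (h2 : ∀ d ∈ D, ∃ a ∈ F, ∃ w, d = a * p w)
    (h3 : ∀ w, p w ∈ F ↔ w ∈ Subgroup.normalClosure {surfaceRelator (k + 1)}) :
    ∃ θ : D →* Equiv.Perm (F × F), ∀ x : D, (x : Γ) ∈ F → θ x = 1 → x = 1 := by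
  have hr : p (surfaceRelator (k + 1)) ∈ F :=
    (h3 _).2 (Subgroup.subset_normalClosure rfl)
  obtain ⟨q, hq, hqr⟩ := exists_perm_rep F k p hr
  have hker : ∀ w, w ∈ Subgroup.normalClosure {surfaceRelator (k + 1)} →
      ∀ h : p w ∈ F, q w = leftPerm F ⟨_, h⟩ := by
    let K : Subgroup (FreeGroup (Fin (k + 1) × Bool)) :=
      { carrier := {w | ∃ h : p w ∈ F, q w = leftPerm F ⟨_, h⟩}
        one_mem' := ⟨by simp, by
          rw [map_one, ← map_one (leftPerm F)]; congr 1; ext; simp⟩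
        mul_mem' := by
          rintro a b ⟨ha, ha'⟩ ⟨hb, hb'⟩
          refine ⟨by rw [map_mul]; exact F.mul_mem ha hb, ?_⟩
          rw [map_mul, ha', hb', ← map_mul]; congr 1; ext; simp
        inv_mem' := by
          rintro a ⟨ha, ha'⟩
          refine ⟨by rw [map_inv]; exact F.inv_mem ha, ?_⟩
          rw [map_inv, ha', ← map_inv]; congr 1; ext; simp }
    have hK : K.Normal := by
      refine ⟨?_⟩
      rintro n ⟨hn, hn'⟩ g
      refine ⟨by simpa using ‹F.Normal›.conj_mem _ hn (p g), ?_⟩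
      rw [map_mul, map_mul, map_inv, hn', hq]; congr 1; ext
      simp [MulAut.conjNormal_apply]
    have : Subgroup.normalClosure {surfaceRelator (k + 1)} ≤ K := by
      apply Subgroup.normalClosure_le_normal
      rintro _ rfl
      exact ⟨hr, hqr⟩
    intro w hw h
    exact (this hw).2
  have hwd : ∀ (a a' : F) w w', (a : Γ) * p w = a' * p w' →
      leftPerm F a * q w = leftPerm F a' * q w' := by
    intro a a' w w' h
    have e : p (w * w'⁻¹) = ((a⁻¹ * a' : F) : Γ) := by
      simp only [map_mul, map_inv, Subgroup.coe_mul, Subgroup.coe_inv]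
      rw [mul_inv_eq_iff_eq_mul, mul_assoc, ← h]; group
    have hm : p (w * w'⁻¹) ∈ F := by rw [e]; exact (a⁻¹ * a').2
    have := hker _ ((h3 _).1 hm) hm
    have e2 : (⟨_, hm⟩ : F) = a⁻¹ * a' := Subtype.ext e
    rw [e2, map_mul, map_mul, map_inv, map_inv, mul_inv_eq_iff_eq_mul] at this
    rw [this]; group
  have h2' : ∀ d : D, ∃ (a : F) (w : _), (d : Γ) = a * p w := by
    intro d
    obtain ⟨a, ha, w, hw⟩ := h2 d d.2
    exact ⟨⟨a, ha⟩, w, hw⟩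
  choose a w haw using h2'
  refine ⟨MonoidHom.mk' (fun d => leftPerm F (a d) * q (w d)) ?_, ?_⟩
  · intro x y
    have : leftPerm F (a (x * y)) * q (w (x * y)) =
        leftPerm F (a x * MulAut.conjNormal (p (w x)) (a y)) * q (w x * w y) := by
      apply hwd
      rw [← haw]
      simp only [Subgroup.coe_mul, MulAut.conjNormal_apply, map_mul]
      rw [haw x, haw y]
      group
    rw [this, map_mul, map_mul, ← hq]; group
  · intro x hx h1
    have h1' : leftPerm F (a x) * q (w x) = 1 := h1
    have := hwd (a x) ⟨x, hx⟩ (w x) 1 (by rw [← haw]; simp)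
    rw [h1', map_one, mul_one] at this
    have h5 := congrArg (fun z : Equiv.Perm (F × F) => (z (1, 1)).1) this
    simp only [leftPerm_apply, Equiv.Perm.one_apply, mul_one] at h5
    have h6 := congrArg (Subtype.val) h5
    ext
    simpa using h6.symm

/-- The one-step bound. -/
def stepBound (m g : ℕ) : ℕ :=
  ((m * m).factorial) ^ (((m * m).factorial) ^ (2 * g + m))

theorem stepBound_mono {m m' g g' : ℕ} (h : m ≤ m') (hg : g ≤ g') :
    stepBound m g ≤ stepBound m' g' := by
  unfold stepBound
  have h1 : (m * m).factorial ≤ (m' * m').factorial :=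
    Nat.factorial_le (Nat.mul_le_mul h h)
  have h0 : 1 ≤ (m' * m').factorial := Nat.factorial_pos _
  refine (Nat.pow_le_pow_left h1 _).trans (Nat.pow_le_pow_right h0 ?_)
  refine (Nat.pow_le_pow_left h1 _).trans (Nat.pow_le_pow_right h0 ?_)
  omega

theorem step_finite {Γ : Type*} [Group Γ] (F D : Subgroup Γ) [F.Normal] [D.Normal] [Finite F]
    (hFD : F ≤ D) (k : ℕ) (hS : SurfData F D (k + 1)) :
    ∃ C : Subgroup Γ, C.Normal ∧ C ≤ D ∧ C ⊓ F = ⊥ ∧ C.relIndex D ≠ 0 ∧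
      C.relIndex D ≤ stepBound (Nat.card F) (k + 1) := by
  classical
  obtain ⟨p, h1, h2, h3⟩ := hS
  obtain ⟨θ, hθ⟩ := exists_hom F D hFD k p h2 h3
  let P := Equiv.Perm (F × F)
  let Ψ : D →* ((D →* P) → P) := MonoidHom.pi fun h => h
  -- homs are determined by generators
  let res : (D →* P) → ((Fin (k + 1) × Bool) ⊕ F → P) := fun h t =>
    Sum.elim (fun t => h ⟨p (FreeGroup.of t), h1 _⟩) (fun f : F => h ⟨(f : Γ), hFD f.2⟩) t
  have hres : Function.Injective res := by
    intro h h' e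
    have eF : ∀ f : F, h ⟨f, hFD f.2⟩ = h' ⟨f, hFD f.2⟩ := fun f => congrFun e (Sum.inr f)
    have eG : h.comp (p.codRestrict D h1) = h'.comp (p.codRestrict D h1) := by
      apply FreeGroup.ext_hom
      intro t
      exact congrFun e (Sum.inl t)
    ext1 d
    obtain ⟨a, ha, w, hw⟩ := h2 d d.2
    have hd : d = ⟨a, hFD ha⟩ * p.codRestrict D h1 w := Subtype.ext hw
    rw [hd, map_mul, map_mul, eF ⟨a, ha⟩]
    congr 1
    exact DFunLike.congr_fun eG w
  have : Finite (D →* P) := Finite.of_injective res hres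
  have hP : Nat.card P = (Nat.card F * Nat.card F).factorial := by
    rw [Nat.card_perm, Nat.card_prod]
  have hcard : Nat.card (D →* P) ≤ Nat.card P ^ (2 * (k + 1) + Nat.card F) := by
    refine (Nat.card_le_card_of_injective res hres).trans ?_
    rw [Nat.card_fun, Nat.card_sum, Nat.card_prod]
    simp [mul_comm]
  refine ⟨Ψ.ker.map D.subtype, ?_, ?_, ?_, ?_⟩
  · refine ⟨?_⟩
    rintro _ ⟨x, hx, rfl⟩ g
    refine ⟨MulAut.conjNormal g x, ?_, by simp [MulAut.conjNormal_apply]⟩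
    have hx' : Ψ x = 1 := hx
    change Ψ _ = 1
    funext h
    exact congrFun hx' (h.comp (MulAut.conjNormal g : MulAut D).toMonoidHom)
  · rintro _ ⟨x, hx, rfl⟩
    exact x.2
  · rw [eq_bot_iff]
    rintro _ ⟨⟨x, hx, rfl⟩, hxF⟩
    have hx' : Ψ x = 1 := hx
    have := hθ x hxF (congrFun hx' θ)
    simp [this]
  · have e : (Ψ.ker.map D.subtype).relIndex D = Nat.card Ψ.range := by
      rw [← Subgroup.index_ker, Subgroup.relIndex]
      congr 1
      exact Subgroup.comap_map_eq_self_of_injective D.subtype_injective _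
    rw [e]
    refine ⟨Nat.card_pos.ne', ?_⟩
    refine (Nat.card_le_card_of_injective _ Ψ.range.subtype_injective).trans ?_
    rw [Nat.card_fun, stepBound, ← hP]
    exact Nat.pow_le_pow_right Nat.card_pos hcard

theorem step {Γ : Type*} [Group Γ] (N A D : Subgroup Γ) [N.Normal] [A.Normal] [D.Normal]
    (hNA : N ≤ A) (hAD : A ≤ D) (h0 : N.relIndex A ≠ 0) (k : ℕ) (hS : SurfData A D (k + 1)) :
    ∃ C : Subgroup Γ, C.Normal ∧ C ≤ D ∧ C ⊓ A ≤ N ∧ C.relIndex D ≠ 0 ∧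
      C.relIndex D ≤ stepBound (N.relIndex A) (k + 1) := by
  let π := QuotientGroup.mk' N
  have hπ : Function.Surjective π := QuotientGroup.mk'_surjective N
  have hk : π.ker = N := QuotientGroup.ker_mk' N
  have i1 : (A.map π).Normal := Subgroup.Normal.map ‹_› _ hπ
  have i2 : (D.map π).Normal := Subgroup.Normal.map ‹_› _ hπ
  have memA : ∀ x, π x ∈ A.map π ↔ x ∈ A := by
    intro x
    rw [← Subgroup.mem_comap, Subgroup.comap_map_eq, hk, sup_eq_left.2 hNA]
  have memD : ∀ x, π x ∈ D.map π ↔ x ∈ D := by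
    intro x
    rw [← Subgroup.mem_comap, Subgroup.comap_map_eq, hk, sup_eq_left.2 (hNA.trans hAD)]
  have hc : Nat.card (A.map π) = N.relIndex A := by
    rw [← Subgroup.relIndex_bot_left, ← Subgroup.relIndex_comap, MonoidHom.comap_bot, hk]
  have : Finite (A.map π) := Nat.finite_of_card_ne_zero (by rw [hc]; exact h0)
  have hS' : SurfData (A.map π) (D.map π) (k + 1) := by
    obtain ⟨p, h1, h2, h3⟩ := hS
    refine ⟨π.comp p, fun w => (memD _).2 (h1 w), ?_, fun w => (memA _).trans (h3 w)⟩
    rintro _ ⟨d, hd, rfl⟩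
    obtain ⟨a, ha, w, rfl⟩ := h2 d hd
    exact ⟨π a, (memA _).2 ha, w, by simp⟩
  obtain ⟨C, c1, c2, c3, c4, c5⟩ := step_finite (A.map π) (D.map π) (Subgroup.map_mono hAD) k hS'
  refine ⟨C.comap π, c1.comap _, ?_, ?_, ?_, ?_⟩
  · intro x hx
    exact (memD x).1 (c2 hx)
  · rintro x ⟨hx, hxA⟩
    have : π x ∈ C ⊓ A.map π := ⟨hx, (memA x).2 hxA⟩
    rw [c3, Subgroup.mem_bot] at this
    rw [← hk]; exact this
  · rwa [Subgroup.relIndex_comap]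
  · rwa [Subgroup.relIndex_comap, ← hc]

theorem surfData_of_hom {G Γ : Type*} [Group G] [Group Γ] (φ : Γ →* G)
    (hφ : Function.Surjective φ) (A D : Subgroup G) (g : ℕ)
    (f : D →* SurfaceGroup g) (hf : Function.Surjective f) (hk : f.ker = A.subgroupOf D) :
    SurfData (A.comap φ) (D.comap φ) g := by
  have hlift : ∀ t : Fin g × Bool, ∃ x : Γ, ∃ h : φ x ∈ D, f ⟨φ x, h⟩ = PresentedGroup.of t := by
    intro t
    obtain ⟨⟨d, hd⟩, e⟩ := hf (PresentedGroup.of t)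
    obtain ⟨x, rfl⟩ := hφ d
    exact ⟨x, hd, e⟩
  choose x hx hfx using hlift
  let p' : FreeGroup (Fin g × Bool) →* D.comap φ := FreeGroup.lift fun t => ⟨x t, hx t⟩
  let r : D.comap φ →* D := φ.subgroupComap D
  have hpr : (f.comp r).comp p' =
      PresentedGroup.mk ({surfaceRelator g} : Set (FreeGroup (Fin g × Bool))) := by
    apply FreeGroup.ext_hom
    intro t
    simp only [MonoidHom.comp_apply, p', FreeGroup.lift_apply_of]
    exact hfx t
  have memA : ∀ d : D.comap φ, (d : Γ) ∈ A.comap φ ↔ f (r d) = 1 := by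
    intro d
    rw [← MonoidHom.mem_ker, hk, Subgroup.mem_subgroupOf]
    rfl
  refine ⟨(D.comap φ).subtype.comp p', fun w => (p' w).2, ?_, ?_⟩
  · intro d hd
    obtain ⟨w, hw⟩ := PresentedGroup.mk_surjective
      ({surfaceRelator g} : Set (FreeGroup (Fin g × Bool))) (f (r ⟨d, hd⟩))
    refine ⟨d * (p' w : Γ)⁻¹, ?_, w, by simp⟩
    have := (memA (⟨d, hd⟩ * (p' w)⁻¹)).2 (by
      rw [map_mul, map_mul, map_inv, map_inv, ← hw, ← hpr]; simp)
    simpa using this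
  · intro w
    refine (memA (p' w)).trans ?_
    rw [← PresentedGroup.mk_eq_one_iff, ← hpr]
    rfl

/-- The iterated bound. -/
def iterBound (γ m : ℕ) : ℕ → ℕ
  | 0 => m
  | i + 1 => stepBound (iterBound γ m i) γ

end Aux

/-- There is a function `F : ℕ × ℕ × ℕ → ℕ` such that for every `n ≥ 1`,
every polysurface group `G` of length `n` admitting a filtration whose surface
quotients all have genus at most `γ`, and every central extension `φ : Γ → G` by a
finite abelian group `A = ker φ`, the extension is trivial over a subgroup `W ≤ G`
with `[G : W] ≤ F(n, |A|, γ)`. -/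
theorem exists_uniform_bound_for_trivializing_index :
    ∃ F : ℕ × ℕ × ℕ → ℕ,
      ∀ (n γ : ℕ), 1 ≤ n →
      ∀ (G Γ : Type) (_ : Group G) (_ : Group Γ)
        (Gs : Fin (n + 1) → Subgroup G),
        Gs 0 = ⊥ → Gs (Fin.last n) = ⊤ → Monotone Gs →
        (∀ i, (Gs i).Normal) →
        (∀ i : Fin n, ∃ g : ℕ, 2 ≤ g ∧ g ≤ γ ∧
          ∃ f : (Gs i.succ) →* SurfaceGroup g,
            Function.Surjective f ∧ f.ker = (Gs i.castSucc).subgroupOf (Gs i.succ)) →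
        ∀ (φ : Γ →* G), Function.Surjective φ →
          Finite φ.ker → φ.ker ≤ Subgroup.center Γ →
          ∃ W : Subgroup G, W.index ≠ 0 ∧ W.index ≤ F (n, Nat.card φ.ker, γ) ∧
            ∃ s : W →* Γ, ∀ w : W, φ (s w) = (w : G) := by
  refine ⟨fun x => iterBound x.2.2 x.2.1 x.1, ?_⟩
  intro n γ _ G Γ _ _ Gs hG0 hGn hmono hnorm hsurf φ hφ hfin _
  have main : ∀ (i : ℕ) (hi : i < n + 1), ∃ N : Subgroup Γ, N.Normal ∧
      N ≤ (Gs ⟨i, hi⟩).comap φ ∧ N ⊓ φ.ker = ⊥ ∧ N.relIndex ((Gs ⟨i, hi⟩).comap φ) ≠ 0 ∧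
      N.relIndex ((Gs ⟨i, hi⟩).comap φ) ≤ iterBound γ (Nat.card φ.ker) i := by
    intro i
    induction i with
    | zero =>
      intro hi
      have e : (Gs ⟨0, hi⟩).comap φ = φ.ker := by
        have : Gs ⟨0, hi⟩ = ⊥ := hG0
        rw [this, MonoidHom.comap_bot]
      rw [e]
      refine ⟨⊥, inferInstance, bot_le, bot_inf_eq _, ?_, ?_⟩
      · rw [Subgroup.relIndex_bot_left]; exact Nat.card_pos.ne'
      · rw [Subgroup.relIndex_bot_left]; exact le_rfl
    | succ i ih =>
      intro hi
      obtain ⟨N, n1, n2, n3, n4, n5⟩ := ih (by omega)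
      obtain ⟨g, g2, gγ, f, hf, hk⟩ := hsurf ⟨i, by omega⟩
      obtain ⟨k, rfl⟩ : ∃ k, g = k + 1 := ⟨g - 1, by omega⟩
      have hS := surfData_of_hom φ hφ _ _ _ f hf hk
      have i1 : ((Gs ⟨i, by omega⟩).comap φ).Normal := (hnorm _).comap φ
      have i2 : ((Gs ⟨i + 1, hi⟩).comap φ).Normal := (hnorm _).comap φ
      have hle : (Gs ⟨i, by omega⟩).comap φ ≤ (Gs ⟨i + 1, hi⟩).comap φ :=
        Subgroup.comap_mono (hmono (by simp))
      obtain ⟨C, c1, c2, c3, c4, c5⟩ := step N ((Gs ⟨i, Nat.lt_of_succ_lt hi⟩).comap φ)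
        ((Gs ⟨i + 1, hi⟩).comap φ) n2 hle n4 k hS
      refine ⟨C, c1, c2, ?_, c4, c5.trans (stepBound_mono n5 gγ)⟩
      rw [eq_bot_iff, ← n3]
      rintro x ⟨hx, hxk⟩
      refine ⟨c3 ⟨hx, ?_⟩, hxk⟩
      have : φ x = 1 := hxk
      refine Subgroup.mem_comap.2 ?_
      rw [this]; exact one_mem _
  obtain ⟨N, n1, -, n3, n4, n5⟩ := main n (by omega)
  have e : (Gs ⟨n, by omega⟩).comap φ = ⊤ := by
    have : Gs ⟨n, by omega⟩ = ⊤ := hGn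
    rw [this, Subgroup.comap_top]
  rw [e, Subgroup.relIndex_top_right] at n4 n5
  have hd : (N.map φ).index ∣ N.index := Subgroup.index_map_dvd N hφ
  refine ⟨N.map φ, fun h => n4 (by rw [h] at hd; exact Nat.eq_zero_of_zero_dvd hd),
    (Nat.le_of_dvd (Nat.pos_of_ne_zero n4) hd).trans n5, ?_⟩
  have hinj : Function.Injective (φ.subgroupMap N) := by
    rw [injective_iff_map_eq_one]
    intro a ha
    have h1 : φ a = 1 := congrArg Subtype.val ha
    have : (a : Γ) ∈ N ⊓ φ.ker := ⟨a.2, h1⟩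
    rw [n3, Subgroup.mem_bot] at this
    exact Subtype.ext this
  let eq := MulEquiv.ofBijective (φ.subgroupMap N) ⟨hinj, φ.subgroupMap_surjective N⟩
  refine ⟨N.subtype.comp eq.symm.toMonoidHom, fun w => ?_⟩
  exact congrArg Subtype.val (eq.apply_symm_apply w)
end

section
/- Let G be a polysurface group (of any length n ≥ 1), let A be a finite abelian group, and let φ : Γ → G be any surjective group homomorphism with kernel equal to A (the extension need not be central). Then there exists a subgroup W of G of finite index and a group homomorphism s : W → Γ such that φ ∘ s equals the inclusion of W into G and every element of s(W) commutes with every element of A; in particular φ⁻¹(W) ≅ A × W. -/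
open scoped commutatorElement

/-! ### Finite-index characteristic subgroups and finite generation -/

/-- An extension of a finitely generated group by a finitely generated group is
finitely generated. -/
theorem fg_of_extension {G Q : Type*} [Group G] [Group Q] (f : G →* Q)
    (hf : Function.Surjective f) (hk : f.ker.FG) (hQ : Group.FG Q) : Group.FG G := by
  classical
  obtain ⟨S, hS⟩ := hk
  obtain ⟨T, hT⟩ := hQ.out
  choose r hr using hf
  refine ⟨⟨S ∪ T.image r, ?_⟩⟩
  have h1 : f.ker ≤ Subgroup.closure ((S ∪ T.image r : Finset G) : Set G) := by
    rw [← hS]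
    apply Subgroup.closure_mono
    intro x hx
    simp only [Finset.coe_union, Set.mem_union]
    exact Or.inl hx
  have h2 : (⊤ : Subgroup G).map f ≤
      (Subgroup.closure ((S ∪ T.image r : Finset G) : Set G)).map f := by
    refine le_trans le_top ?_
    rw [← hT, Subgroup.closure_le]
    intro t ht
    refine ⟨r t, Subgroup.subset_closure ?_, hr t⟩
    simp only [Finset.coe_union, Set.mem_union, Finset.coe_image]
    exact Or.inr ⟨t, ht, rfl⟩
  rw [Subgroup.map_le_map_iff, sup_eq_left.2 h1] at h2
  exact top_le_iff.1 h2

/-- A finite-index subgroup of a finitely generated group contains a characteristic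
subgroup of finite index. -/
theorem exists_characteristic_le {G : Type*} [Group G] (hG : Group.FG G) (D : Subgroup G)
    [D.FiniteIndex] : ∃ C : Subgroup G, C ≤ D ∧ C.FiniteIndex ∧ C.Characteristic := by
  classical
  obtain ⟨S, hS⟩ := hG.out
  let X := G ⧸ D
  have hX : Finite X := inferInstance
  have hfin : Finite (G →* Equiv.Perm X) := by
    refine Finite.of_injective
      (fun f : G →* Equiv.Perm X => fun s : S => f s) ?_
    intro f f' h
    refine MonoidHom.eq_of_eqOn_dense hS ?_
    intro s hs
    exact congrFun h ⟨s, hs⟩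
  refine ⟨⨅ f : G →* Equiv.Perm X, f.ker, ?_, ?_, ?_⟩
  · refine le_trans (iInf_le _ (MulAction.toPermHom G X)) ?_
    intro x hx
    have h1 : MulAction.toPermHom G X x ((1 : G) : G ⧸ D) = ((1 : G) : G ⧸ D) := by
      rw [MonoidHom.mem_ker.1 hx]; rfl
    have h2 : ((x * 1 : G) : G ⧸ D) = ((1 : G) : G ⧸ D) := h1
    rw [QuotientGroup.eq] at h2
    simpa using h2
  · refine Subgroup.finiteIndex_iInf ?_
    intro f
    exact Subgroup.finiteIndex_ker f
  · rw [Subgroup.characteristic_iff_le_comap]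
    intro e x hx
    simp only [Subgroup.mem_comap, Subgroup.mem_iInf] at hx ⊢
    intro f
    exact hx (f.comp e.toMonoidHom)

/-! ### The key case: finite extensions of a surface group -/

section Key

variable {Γ S : Type*} [Group Γ] [Group S] (ψ : Γ →* S) (χ : S →* Equiv.Perm ψ.ker)

/-- The permutation action of `Γ` on `ker ψ × Γ` twisted by `χ`. -/
def twistedAction : Γ →* Equiv.Perm (ψ.ker × Γ) where
  toFun γ := Equiv.prodCongr (χ (ψ γ)) (Equiv.mulLeft γ)
  map_one' := by ext x <;> simp
  map_mul' a b := by ext x <;> simp [mul_assoc]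

theorem twistedAction_apply (γ : Γ) (x : ψ.ker) (δ : Γ) :
    twistedAction ψ χ γ (x, δ) = (χ (ψ γ) x, γ * δ) := rfl

/-- Pairs `(γ, p)` where `p` agrees with the action of `γ` up to multiplication by elements
of the kernel. -/
def nearSubgroup : Subgroup (Γ × Equiv.Perm (ψ.ker × Γ)) where
  carrier := {q | ∃ h : ψ.ker → ψ.ker, ∀ x δ,
    q.2 (x, δ) = (χ (ψ q.1) x, (h x : Γ) * (q.1 * δ))}
  one_mem' := ⟨fun _ => 1, fun x δ => by simp⟩
  mul_mem' := by
    rintro ⟨a, p⟩ ⟨b, q⟩ ⟨h, hh⟩ ⟨k, hk⟩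
    refine ⟨fun x => h (χ (ψ b) x) *
      ⟨a * k x * a⁻¹, (inferInstance : ψ.ker.Normal).conj_mem _ (k x).2 a⟩, fun x δ => ?_⟩
    simp only at hh hk
    simp [hh, hk, mul_assoc]
  inv_mem' := by
    rintro ⟨a, p⟩ ⟨h, hh⟩
    refine ⟨fun x => ⟨a⁻¹ * ((h ((χ (ψ a))⁻¹ x))⁻¹ : ψ.ker) * a, by
      simpa using (inferInstance : ψ.ker.Normal).conj_mem _
        ((h ((χ (ψ a))⁻¹ x))⁻¹ : ψ.ker).2 a⁻¹⟩, fun x δ => ?_⟩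
    simp only at hh
    change p⁻¹ (x, δ) = _
    rw [Equiv.Perm.inv_eq_iff_eq]
    simp [hh, mul_assoc]

/-- If some homomorphism `σ` from the quotient stays near the twisted action, then the
locus where the two agree has finite index and misses the kernel. -/
theorem exists_finiteIndex_of_near [Finite ψ.ker] (σ : S →* Equiv.Perm (ψ.ker × Γ))
    (hσ : ∀ γ, (γ, σ (ψ γ)) ∈ nearSubgroup ψ χ) :
    ∃ D : Subgroup Γ, D.FiniteIndex ∧ D ⊓ ψ.ker = ⊥ := by
  classical
  refine ⟨MonoidHom.eqLocus (twistedAction ψ χ) (σ.comp ψ), ?_, ?_⟩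
  · have key : ∀ γ, ∃ h : ψ.ker → ψ.ker, ∀ x δ,
        (twistedAction ψ χ γ * (σ (ψ γ))⁻¹) (x, δ) = (x, (h x : Γ) * δ) := by
      intro γ
      have h1 : (γ, twistedAction ψ χ γ) ∈ nearSubgroup ψ χ :=
        ⟨fun _ => 1, fun x δ => by simp [twistedAction_apply]⟩
      obtain ⟨h, hh⟩ := (nearSubgroup ψ χ).mul_mem h1 ((nearSubgroup ψ χ).inv_mem (hσ γ))
      refine ⟨h, fun x δ => ?_⟩
      simpa using hh x δ
    choose F hF using key
    have : Finite (Γ ⧸ MonoidHom.eqLocus (twistedAction ψ χ) (σ.comp ψ)) := by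
      refine Finite.of_injective (β := ψ.ker → ψ.ker) (fun q => F q.out) ?_
      intro q q' hq
      simp only at hq
      have h2 : twistedAction ψ χ q.out * (σ (ψ q.out))⁻¹ =
          twistedAction ψ χ q'.out * (σ (ψ q'.out))⁻¹ := by
        refine Equiv.ext ?_
        rintro ⟨x, δ⟩
        rw [hF, hF, hq]
      rw [← QuotientGroup.out_eq' q, ← QuotientGroup.out_eq' q', QuotientGroup.eq]
      change twistedAction ψ χ _ = σ (ψ _)
      simp only [map_mul, map_inv]
      rw [inv_mul_eq_iff_eq_mul, ← mul_assoc, ← mul_inv_eq_iff_eq_mul, h2]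
    exact Subgroup.finiteIndex_of_finite_quotient
  · rw [eq_bot_iff]
    rintro γ ⟨h1, h2⟩
    have h3 : twistedAction ψ χ γ = σ (ψ γ) := h1
    have h4 : ψ γ = 1 := h2
    rw [h4, map_one] at h3
    have h5 := congrArg (fun p => (p (1, 1)).2) h3
    simpa [twistedAction_apply] using h5

end Key

/-- Any extension of a surface group by a finite group has a finite-index subgroup
missing the kernel. -/
theorem surface_key {Γ : Type*} [Group Γ] {g : ℕ} (hg : 2 ≤ g)
    (ψ : Γ →* SurfaceGroup g) (hψ : Function.Surjective ψ) [Finite ψ.ker] :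
    ∃ D : Subgroup Γ, D.FiniteIndex ∧ D ⊓ ψ.ker = ⊥ := by
  classical
  obtain ⟨k, rfl⟩ : ∃ k, g = k + 1 := ⟨g - 1, by omega⟩
  choose r hr using hψ
  let a : Fin (k + 1) × Bool → Γ := fun x => r (PresentedGroup.of x)
  have ha : ∀ x, ψ (a x) = PresentedGroup.of x := fun x => hr _
  have hlift : ∀ w, ψ (FreeGroup.lift a w) = PresentedGroup.mk _ w := by
    intro w
    have : ψ.comp (FreeGroup.lift a) = PresentedGroup.mk _ := by
      ext x
      simp only [MonoidHom.comp_apply, FreeGroup.lift_apply_of]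
      exact ha x
    exact DFunLike.congr_fun this w
  let R : Γ := (List.ofFn fun i : Fin k => ⁅a (i.succ, true), a (i.succ, false)⁆).prod
  let a₀ := a (0, true)
  let b₀ := a (0, false)
  have hc : ψ (⁅a₀, b₀⁆ * R) = 1 := by
    have h1 : FreeGroup.lift a (surfaceRelator (k + 1)) = ⁅a₀, b₀⁆ * R := by
      simp [surfaceRelator, R, a₀, b₀, List.ofFn_succ, map_list_prod, List.map_ofFn,
        Function.comp_def, map_commutatorElement]
    rw [← h1, hlift]
    exact PresentedGroup.one_of_mem (by simp)
  let c : ψ.ker := ⟨⁅a₀, b₀⁆ * R, hc⟩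
  let u : Γ := a₀ * b₀ * a₀⁻¹
  let T : Equiv.Perm ψ.ker := (MulAut.conjNormal u : MulAut ψ.ker).toEquiv.trans
    (Equiv.mulLeft c⁻¹)
  have hT : ∀ y : ψ.ker, ((T y : ψ.ker) : Γ) = (⁅a₀, b₀⁆ * R)⁻¹ * (u * y * u⁻¹) := by
    intro y
    simp [T, c, MulAut.conjNormal_apply]
  -- the character
  let t : Fin (k + 1) × Bool → Equiv.Perm ψ.ker := fun x => if x = (0, false) then T else 1
  have ht : ∀ w ∈ ({surfaceRelator (k + 1)} : Set (FreeGroup (Fin (k + 1) × Bool))),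
      FreeGroup.lift t w = 1 := by
    intro w hw
    rw [Set.mem_singleton_iff] at hw
    subst hw
    simp [surfaceRelator, map_list_prod, List.map_ofFn, Function.comp_def,
        map_commutatorElement, t]
  let χ : SurfaceGroup (k + 1) →* Equiv.Perm ψ.ker := PresentedGroup.toGroup ht
  have hχ : ∀ x, χ (PresentedGroup.of x) = t x := fun x => PresentedGroup.toGroup.of ht
  let α : Equiv.Perm (ψ.ker × Γ) :=
    { toFun := fun p => (p.1, p.1 * (a₀ * p.2))
      invFun := fun p => (p.1, a₀⁻¹ * ((p.1 : Γ)⁻¹ * p.2))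
      left_inv := fun p => by simp
      right_inv := fun p => by simp }
  let s : Fin (k + 1) × Bool → Equiv.Perm (ψ.ker × Γ) := fun x =>
    if x = (0, true) then α else twistedAction ψ χ (a x)
  have hs : ∀ w ∈ ({surfaceRelator (k + 1)} : Set (FreeGroup (Fin (k + 1) × Bool))),
      FreeGroup.lift s w = 1 := by
    intro w hw
    rw [Set.mem_singleton_iff] at hw
    subst hw
    have h1 : FreeGroup.lift s (surfaceRelator (k + 1)) =
        ⁅α, twistedAction ψ χ b₀⁆ * twistedAction ψ χ R := by
      simp [surfaceRelator, R, b₀, List.ofFn_succ, map_list_prod, List.map_ofFn,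
        Function.comp_def, map_commutatorElement, s]
    have hχR : χ (ψ R) = 1 := by
      simp [R, map_list_prod, List.map_ofFn, Function.comp_def, map_commutatorElement,
        ha, hχ, t]
    have hχb : χ (ψ b₀) = T := by simp [b₀, ha, hχ, t]
    rw [h1]
    -- evaluate at points of the form `β (α y)`
    have hR : ∀ x δ, twistedAction ψ χ R (x, δ) = (x, R * δ) := by
      intro x δ
      rw [twistedAction_apply, hχR]
      rfl
    have hRinv : ∀ x δ, (twistedAction ψ χ R)⁻¹ (x, δ) = (x, R⁻¹ * δ) := by
      intro x δ
      rw [Equiv.Perm.inv_eq_iff_eq, hR, mul_inv_cancel_left]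
    have hb : ∀ x δ, twistedAction ψ χ b₀ (x, δ) = (T x, b₀ * δ) := by
      intro x δ
      rw [twistedAction_apply, hχb]
    have hα : ∀ x δ, α (x, δ) = (x, (x : Γ) * (a₀ * δ)) := fun x δ => rfl
    rw [commutatorElement_def, mul_eq_one_iff_eq_inv, mul_inv_eq_iff_eq_mul,
      mul_inv_eq_iff_eq_mul]
    refine Equiv.ext ?_
    rintro ⟨x, δ⟩
    simp only [Equiv.Perm.mul_apply, hα, hb, hRinv, hT]
    refine Prod.ext rfl ?_
    simp only [u, commutatorElement_def]
    group
  let σ : SurfaceGroup (k + 1) →* Equiv.Perm (ψ.ker × Γ) := PresentedGroup.toGroup hs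
  have hσ : ∀ w, σ (PresentedGroup.mk _ w) = FreeGroup.lift s w := fun w => rfl
  refine exists_finiteIndex_of_near ψ χ σ ?_
  have hw : ∀ w, (FreeGroup.lift a w, FreeGroup.lift s w) ∈ nearSubgroup ψ χ := by
    intro w
    have h1 : ∀ x, (a x, s x) ∈ nearSubgroup ψ χ := by
      intro x
      by_cases hx : x = (0, true)
      · subst hx
        refine ⟨fun y => y, fun y δ => ?_⟩
        have : χ (ψ (a (0, true))) = 1 := by simp [ha, hχ, t]
        simp only [this, s, if_true]
        rfl
      · refine ⟨fun y => 1, fun y δ => ?_⟩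
        simp [s, hx, twistedAction_apply]
    induction w using FreeGroup.induction_on with
    | C1 =>
      rw [map_one, map_one]
      exact (nearSubgroup ψ χ).one_mem
    | of x => simpa using h1 x
    | inv_of x _ => simpa using (nearSubgroup ψ χ).inv_mem (h1 x)
    | mul x y hx hy => simpa using (nearSubgroup ψ χ).mul_mem hx hy
  intro γ
  obtain ⟨w, hwγ⟩ := PresentedGroup.mk_surjective _ (ψ γ)
  have hk : ψ (γ * (FreeGroup.lift a w)⁻¹) = 1 := by
    rw [map_mul, map_inv, hlift, hwγ, mul_inv_cancel]
  have h1 : (γ * (FreeGroup.lift a w)⁻¹, (1 : Equiv.Perm (ψ.ker × Γ))) ∈ nearSubgroup ψ χ := by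
    refine ⟨fun _ => (⟨_, hk⟩ : ψ.ker)⁻¹, fun x δ => ?_⟩
    simp only [hk]
    simp [mul_assoc]
  have h2 := (nearSubgroup ψ χ).mul_mem h1 (hw w)
  rw [← hwγ, hσ]
  simpa using h2

/-- Relative version: pass to the quotient by a normal subgroup `M` of finite index
in the kernel. -/
theorem surface_key_rel {Γ : Type*} [Group Γ] {g : ℕ} (hg : 2 ≤ g)
    (ψ : Γ →* SurfaceGroup g) (hψ : Function.Surjective ψ) (M : Subgroup Γ) [M.Normal]
    (hM : M ≤ ψ.ker) (hfi : M.relIndex ψ.ker ≠ 0) :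
    ∃ D : Subgroup Γ, D.FiniteIndex ∧ D ⊓ ψ.ker ≤ M := by
  let ψ' : Γ ⧸ M →* SurfaceGroup g := QuotientGroup.lift M ψ hM
  have hψ' : Function.Surjective ψ' := by
    intro y
    obtain ⟨x, rfl⟩ := hψ y
    exact ⟨(x : Γ ⧸ M), rfl⟩
  have hker : ψ'.ker = ψ.ker.map (QuotientGroup.mk' M) := by
    ext q
    obtain ⟨x, rfl⟩ := QuotientGroup.mk'_surjective M q
    constructor
    · intro h
      exact ⟨x, h, rfl⟩
    · rintro ⟨y, hy, hyx⟩
      rw [← hyx]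
      exact hy
  have hfin : Finite ψ'.ker := by
    have h1 : Finite (ψ.ker ⧸ M.subgroupOf ψ.ker) :=
      (Subgroup.fintypeOfIndexNeZero hfi).finite
    let f : ψ.ker → ψ'.ker := fun x => ⟨((x : Γ) : Γ ⧸ M), x.2⟩
    refine Finite.of_surjective (fun q : ψ.ker ⧸ M.subgroupOf ψ.ker => f q.out) ?_
    rintro ⟨q, hq⟩
    obtain ⟨x, rfl⟩ := QuotientGroup.mk_surjective q
    refine ⟨((⟨x, hq⟩ : ψ.ker) : ψ.ker ⧸ M.subgroupOf ψ.ker), ?_⟩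
    apply Subtype.ext
    change (((Quotient.out _ : ψ.ker) : Γ) : Γ ⧸ M) = (x : Γ ⧸ M)
    rw [QuotientGroup.eq]
    have h2 := QuotientGroup.out_eq' ((⟨x, hq⟩ : ψ.ker) : ψ.ker ⧸ M.subgroupOf ψ.ker)
    rw [QuotientGroup.eq] at h2
    exact h2
  obtain ⟨D, hD, hD'⟩ := surface_key hg ψ' hψ'
  refine ⟨D.comap (QuotientGroup.mk' M), ⟨?_⟩, ?_⟩
  · rw [Subgroup.index_comap_of_surjective _ (QuotientGroup.mk'_surjective M)]
    exact hD.index_ne_zero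
  rintro x ⟨h1, h2⟩
  have h3 : (x : Γ ⧸ M) ∈ D ⊓ ψ'.ker := ⟨h1, h2⟩
  rw [hD', Subgroup.mem_bot] at h3
  exact (QuotientGroup.eq_one_iff x).1 h3

/-- One step up the filtration. -/
theorem polysurface_step {Γ : Type*} [Group Γ] (A H H' : Subgroup Γ) [H'.Normal]
    (hA : A ≤ H) {g : ℕ} (hg : 2 ≤ g)
    (f : H' →* SurfaceGroup g) (hf : Function.Surjective f) (hk : f.ker = H.subgroupOf H')
    (hHH' : H ≤ H') (hfg : H.FG)
    (M : Subgroup Γ) (hMn : M.Normal) (hMH : M ≤ H) (hMi : M.relIndex H ≠ 0)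
    (hMA : M ⊓ A = ⊥) :
    H'.FG ∧ ∃ M' : Subgroup Γ, M'.Normal ∧ M' ≤ H' ∧ M'.relIndex H' ≠ 0 ∧ M' ⊓ A = ⊥ := by
  have hfgS : Group.FG (SurfaceGroup g) :=
    Group.fg_of_surjective (PresentedGroup.mk_surjective _)
  have hkfg : f.ker.FG := by
    rw [hk]
    rw [← Group.fg_iff_subgroup_fg] at hfg ⊢
    exact Group.fg_of_surjective (f := (Subgroup.subgroupOfEquivOfLe hHH').symm.toMonoidHom)
      (Subgroup.subgroupOfEquivOfLe hHH').symm.surjective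
  have hG : Group.FG H' := fg_of_extension f hf hkfg hfgS
  refine ⟨(Group.fg_iff_subgroup_fg _).1 hG, ?_⟩
  have hM1 : M.subgroupOf H' ≤ f.ker := by
    rw [hk]
    intro x hx
    exact hMH hx
  have hM2 : (M.subgroupOf H').relIndex f.ker ≠ 0 := by
    rw [hk, Subgroup.relIndex_subgroupOf hHH']
    exact hMi
  obtain ⟨D, hD, hDM⟩ := surface_key_rel hg f hf (M.subgroupOf H') hM1 hM2
  obtain ⟨C, hCD, hCi, hCc⟩ := exists_characteristic_le hG D
  refine ⟨C.map H'.subtype, inferInstance, Subgroup.map_subtype_le C, ?_, ?_⟩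
  · have : (C.map H'.subtype).subgroupOf H' = C :=
      Subgroup.comap_map_eq_self_of_injective H'.subtype_injective C
    rw [Subgroup.relIndex, this]
    exact hCi.index_ne_zero
  · rw [eq_bot_iff]
    rintro _ ⟨⟨x, hx, rfl⟩, hxA⟩
    have h1 : x ∈ f.ker := by
      rw [hk]
      exact hA hxA
    have h2 : x ∈ M.subgroupOf H' := hDM ⟨hCD hx, h1⟩
    rw [← hMA]
    exact ⟨h2, hxA⟩

/-- A polysurface-by-finite extension has a normal finite-index subgroup missing the
finite kernel. -/
theorem polysurface_key {G Γ : Type*} [Group G] [Group Γ] {n : ℕ}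
    (hG : IsPolysurface G n) (φ : Γ →* G) (hφ : Function.Surjective φ) [Finite φ.ker] :
    ∃ M : Subgroup Γ, M.Normal ∧ M.index ≠ 0 ∧ M ⊓ φ.ker = ⊥ := by
  obtain ⟨Gs, h0, hlast, hmono, hnorm, hstep⟩ := hG
  have main : ∀ i : Fin (n + 1), ((Gs i).comap φ).FG ∧ ∃ M : Subgroup Γ, M.Normal ∧
      M ≤ (Gs i).comap φ ∧ M.relIndex ((Gs i).comap φ) ≠ 0 ∧ M ⊓ φ.ker = ⊥ := by
    intro i
    induction i using Fin.induction with
    | zero =>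
      rw [h0, MonoidHom.comap_bot]
      refine ⟨?_, ⊥, inferInstance, bot_le, ?_, by simp⟩
      · rw [← Group.fg_iff_subgroup_fg]
        infer_instance
      · rw [Subgroup.relIndex_bot_left]
        exact Nat.card_pos.ne'
    | succ i ih =>
      obtain ⟨hfg, M, hMn, hMH, hMi, hMA⟩ := ih
      obtain ⟨g, hg, f, hf, hk⟩ := hstep i
      have := hnorm i.succ
      let p : (Gs i.succ).comap φ →* Gs i.succ := φ.subgroupComap (Gs i.succ)
      have hp : Function.Surjective p := φ.subgroupComap_surjective_of_surjective _ hφ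
      refine polysurface_step φ.ker ((Gs i.castSucc).comap φ) ((Gs i.succ).comap φ) ?_ hg
        (f.comp p) (hf.comp hp) ?_ ?_ hfg M hMn hMH hMi hMA
      · intro x hx
        rw [Subgroup.mem_comap, MonoidHom.mem_ker.1 hx]
        exact one_mem _
      · rw [← MonoidHom.comap_ker, hk]
        rfl
      · exact Subgroup.comap_mono (hmono (Fin.castSucc_lt_succ).le)
  obtain ⟨_, M, hMn, _, hMi, hMA⟩ := main (Fin.last n)
  rw [hlast, Subgroup.comap_top, Subgroup.relIndex_top_right] at hMi
  exact ⟨M, hMn, hMi, hMA⟩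

/-- Let `G` be a polysurface group, and let `φ : Γ → G` be a surjective
homomorphism whose kernel `A = ker φ` is a finite abelian group (the extension need not
be central). Then there is a finite-index subgroup `W ≤ G` and a splitting `s : W → Γ`
of `φ` whose image commutes elementwise with `A`; in particular `φ⁻¹(W) ≅ A × W`. -/
theorem extension_of_polysurface_by_finite_abelian_virtually_splits
    {G Γ : Type*} [Group G] [Group Γ] {n : ℕ} (hn : 1 ≤ n)
    (hG : IsPolysurface G n)
    (φ : Γ →* G) (hφ : Function.Surjective φ)
    (hfin : Finite φ.ker) (hab : ∀ a b : φ.ker, a * b = b * a) :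
    ∃ W : Subgroup G, W.index ≠ 0 ∧
      ∃ s : W →* Γ, (∀ w : W, φ (s w) = (w : G)) ∧
        (∀ (w : W) (a : φ.ker), Commute (s w) (a : Γ)) ∧
        Nonempty ((W.comap φ) ≃* (φ.ker × W)) := by
  obtain ⟨M, hMn, hMi, hMA⟩ := polysurface_key hG φ hφ
  let f : M →* G := φ.comp M.subtype
  have hf : Function.Injective f := by
    rw [injective_iff_map_eq_one]
    intro x hx
    have h1 : (x : Γ) ∈ M ⊓ φ.ker := ⟨x.2, hx⟩
    rw [hMA, Subgroup.mem_bot] at h1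
    exact Subtype.ext h1
  let e : M ≃* f.range := MonoidHom.ofInjective hf
  have he : ∀ w : f.range, φ (e.symm w : M) = (w : G) := by
    intro w
    have h1 : ((e (e.symm w) : f.range) : G) = w := by rw [e.apply_symm_apply]
    exact h1
  have hcomm : ∀ (m : M) (a : φ.ker), Commute (m : Γ) (a : Γ) := fun m a =>
    Subgroup.commute_of_normal_of_disjoint M φ.ker hMn inferInstance
      (disjoint_iff.2 hMA) m a m.2 a.2
  let s : f.range →* Γ := M.subtype.comp e.symm.toMonoidHom
  have hs : ∀ w : f.range, φ (s w) = (w : G) := he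
  have hsc : ∀ (w : f.range) (a : φ.ker), Commute (s w) (a : Γ) := fun w a => hcomm _ a
  refine ⟨f.range, ?_, s, hs, hsc, ?_⟩
  · have h1 : f.range = M.map φ := by
      rw [MonoidHom.range_comp, Subgroup.range_subtype]
    rw [h1]
    exact ne_zero_of_dvd_ne_zero hMi (Subgroup.index_map_dvd M hφ)
  · let F : φ.ker × f.range →* f.range.comap φ :=
      { toFun := fun p => ⟨(p.1 : Γ) * s p.2, by
          rw [Subgroup.mem_comap, map_mul, MonoidHom.mem_ker.1 p.1.2, one_mul, hs]
          exact p.2.2⟩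
        map_one' := by
          apply Subtype.ext
          simp
        map_mul' := fun p q => by
          apply Subtype.ext
          have h1 := (hsc p.2 q.1).eq
          simp only [Prod.fst_mul, Prod.snd_mul, Subgroup.coe_mul, map_mul]
          rw [mul_assoc, ← mul_assoc (q.1 : Γ), ← h1]
          simp only [mul_assoc] }
    refine ⟨(MulEquiv.ofBijective F ⟨?_, ?_⟩).symm⟩
    · rw [injective_iff_map_eq_one]
      rintro ⟨a, w⟩ h
      have h1 : (a : Γ) * s w = 1 := congrArg Subtype.val h
      have h2 : w = 1 := by
        apply Subtype.ext
        have h3 := congrArg φ h1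
        rw [map_mul, MonoidHom.mem_ker.1 a.2, one_mul, hs, map_one] at h3
        exact h3
      subst h2
      rw [map_one, mul_one] at h1
      exact Prod.ext (Subtype.ext h1) rfl
    · rintro ⟨x, hx⟩
      refine ⟨(⟨x * (s ⟨φ x, hx⟩)⁻¹, ?_⟩, ⟨φ x, hx⟩), ?_⟩
      · rw [MonoidHom.mem_ker, map_mul, map_inv, hs, mul_inv_cancel]
      · apply Subtype.ext
        change x * (s ⟨φ x, hx⟩)⁻¹ * s ⟨φ x, hx⟩ = x
        rw [inv_mul_cancel_right]
end
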